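/- arXiv:2107.13196 — 4 statements merged into one kernel-verified Lean document; each statement's English description precedes it below -/
import Mathlib

section
/- For any positive integers k, p₁, …, p_k, q with k ≥ 2 and 2 ≤ q ≤ (p₁+⋯+p_k) − 1, the anti-Ramsey number satisfies ar(K_{p₁,…,p_k}, T_q) = ℓ_q(K_{p₁,…,p_k}) + 1. -/
open SimpleGraph

variable {V : Type} [Fintype V]

/-- There is a rainbow (w.r.t. the coloring `c`) subtree of `G` with exactly `q` edges. -/
def hasRainbowTree (G : SimpleGraph V) (c : Sym2 V → ℕ) (q : ℕ) : Prop :=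
  ∃ H : G.Subgraph, H.coe.IsTree ∧ H.edgeSet.ncard = q ∧ Set.InjOn c H.edgeSet

/-- The anti-Ramsey number `ar(G, 𝒯_q)`. -/
noncomputable def ar (G : SimpleGraph V) (q : ℕ) : ℕ :=
  sSup {t | ∃ c : Sym2 V → ℕ, c '' G.edgeSet = Set.Iio t ∧ ¬ hasRainbowTree G c q}

/-- `H` is a disconnected spanning subgraph of `G` in which any two components together
have at most `q` vertices. -/
def inS (G H : SimpleGraph V) (q : ℕ) : Prop :=
  H ≤ G ∧ ¬ H.Connected ∧
    ∀ C D : H.ConnectedComponent, C ≠ D → C.supp.ncard + D.supp.ncard ≤ q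

/-- `ℓ_q(G)`: the maximum number of edges of a graph in `S_q(G)`. -/
noncomputable def ell (G : SimpleGraph V) (q : ℕ) : ℕ :=
  sSup {m | ∃ H : SimpleGraph V, inS G H q ∧ H.edgeSet.ncard = m}


set_option linter.unusedSectionVars false

namespace AR

/-- The vertex set of the component of `v`. -/
def comp (K : SimpleGraph V) (v : V) : Set V := {z | K.Reachable v z}

lemma mem_comp_self (K : SimpleGraph V) (v : V) : v ∈ comp K v := Reachable.refl v

lemma comp_eq {K : SimpleGraph V} {u v : V} (h : K.Reachable u v) : comp K u = comp K v := by
  ext z; exact ⟨fun hz => h.symm.trans hz, fun hz => h.trans hz⟩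

lemma reach_ind {W : Type} {K : SimpleGraph W} {a : W} (P : W → Prop) (h0 : P a)
    (hs : ∀ p r, K.Reachable a p → P p → K.Adj p r → P r) {b : W} (h : K.Reachable a b) : P b := by
  rw [reachable_iff_reflTransGen] at h
  induction h with
  | refl => exact h0
  | tail h1 h2 ih => exact hs _ _ ((reachable_iff_reflTransGen _ _).2 h1) ih h2

lemma transfer {K K' : SimpleGraph V} {a b : V} (h : K.Reachable a b)
    (hs : ∀ p r, K.Reachable a p → K.Adj p r → K'.Adj p r) : K'.Reachable a b :=
  reach_ind (fun z => K'.Reachable a z) (Reachable.refl a)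
    (fun p r hp ih hpr => ih.trans (hs p r hp hpr).reachable) h

lemma del_reach {R : SimpleGraph V} {x y u z : V} (h : R.Reachable u z) :
    (R.deleteEdges {s(x, y)}).Reachable u z ∨ (R.deleteEdges {s(x, y)}).Reachable x z ∨
      (R.deleteEdges {s(x, y)}).Reachable y z := by
  refine reach_ind (fun z => (R.deleteEdges {s(x, y)}).Reachable u z ∨
    (R.deleteEdges {s(x, y)}).Reachable x z ∨
      (R.deleteEdges {s(x, y)}).Reachable y z) (Or.inl (Reachable.refl u)) ?_ h
  intro p r _ ih hpr
  by_cases he : s(p, r) = s(x, y)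
  · rcases Sym2.eq_iff.1 he with ⟨rfl, rfl⟩ | ⟨rfl, rfl⟩
    · exact Or.inr (Or.inr (Reachable.refl _))
    · exact Or.inr (Or.inl (Reachable.refl _))
  · have : (R.deleteEdges {s(x, y)}).Adj p r := by
      rw [deleteEdges_adj]; exact ⟨hpr, he⟩
    rcases ih with h | h | h
    · exact Or.inl (h.trans this.reachable)
    · exact Or.inr (Or.inl (h.trans this.reachable))
    · exact Or.inr (Or.inr (h.trans this.reachable))

lemma card_reach_add {K : SimpleGraph V} {u v : V} (h : ¬ K.Reachable u v) :
    (comp K u ∪ comp K v).ncard = (comp K u).ncard + (comp K v).ncard := by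
  apply Set.ncard_union_eq _ (Set.toFinite _) (Set.toFinite _)
  rw [Set.disjoint_left]
  intro z hu hv
  exact h (Reachable.trans hu (Reachable.symm hv))

lemma isTree_of {G : SimpleGraph V} (H : G.Subgraph) :
    H.coe.IsTree ↔ H.Connected ∧ H.edgeSet.ncard + 1 = H.verts.ncard := by
  rw [isTree_iff_connected_and_card, Subgraph.connected_iff']
  have : Nat.card H.coe.edgeSet = H.edgeSet.ncard := by
    rw [← Subgraph.image_coe_edgeSet_coe, Set.ncard_image_of_injective]
    · rfl
    · exact Sym2.map.injective Subtype.val_injective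
  rw [this]; rfl

lemma grow {G R : SimpleGraph V} (hR : R ≤ G) (v : V) (j : ℕ) (hj : j + 1 ≤ (comp R v).ncard) :
    ∃ H : G.Subgraph, H.Connected ∧ H.edgeSet.ncard = j ∧ H.verts.ncard = j + 1 ∧
      v ∈ H.verts ∧ H.edgeSet ⊆ R.edgeSet := by
  induction j with
  | zero =>
    refine ⟨G.singletonSubgraph v, Subgraph.singletonSubgraph_connected, ?_, ?_, ?_, ?_⟩ <;> simp
  | succ j ih =>
    obtain ⟨H, hc, he, hv, hvv, hs⟩ := ih (by omega)
    have : ∃ p ∈ H.verts, ∃ r, r ∉ H.verts ∧ R.Adj p r := by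
      by_contra! hcon
      have : comp R v ⊆ H.verts := by
        intro z hz
        refine reach_ind (fun z => z ∈ H.verts) hvv ?_ hz
        intro p r _ hp hpr
        by_contra hr
        exact hcon p hp r hr hpr
      have := Set.ncard_le_ncard this (Set.toFinite _)
      omega
    obtain ⟨p, hp, r, hr, hpr⟩ := this
    have hne : s(p, r) ∉ H.edgeSet := fun h => hr (H.edge_vert (Subgraph.Adj.symm h))
    refine ⟨H ⊔ G.subgraphOfAdj (hR hpr), ?_, ?_, ?_, Or.inl hvv, ?_⟩
    · exact Subgraph.connected_sup hc.preconnected (Subgraph.subgraphOfAdj_connected _).preconnected ⟨p, hp, by simp⟩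
    · rw [Subgraph.edgeSet_sup, edgeSet_subgraphOfAdj, Set.union_singleton,
        Set.ncard_insert_of_notMem hne (Set.toFinite _), he]
    · have : (H ⊔ G.subgraphOfAdj (hR hpr)).verts = insert r H.verts := by
        ext z; simp; grind
      rw [this, Set.ncard_insert_of_notMem hr (Set.toFinite _), hv]
    · rw [Subgraph.edgeSet_sup, edgeSet_subgraphOfAdj]
      rintro e (h | h)
      · exact hs h
      · rw [Set.mem_singleton_iff] at h; rw [h]; exact hpr

lemma comp_le {G R : SimpleGraph V} {c : Sym2 V → ℕ} {q : ℕ} (hR : R ≤ G)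
    (hc : Set.InjOn c R.edgeSet) (hn : ¬ hasRainbowTree G c q) (v : V) :
    (comp R v).ncard ≤ q := by
  by_contra! h
  obtain ⟨H, h1, h2, h3, -, h5⟩ := grow hR v q h
  exact hn ⟨H, (isTree_of H).2 ⟨h1, by omega⟩, h2, hc.mono h5⟩

lemma inS_iff {G H : SimpleGraph V} {q : ℕ} : inS G H q ↔ H ≤ G ∧ ¬ H.Connected ∧
    ∀ u v, ¬ H.Reachable u v → (comp H u).ncard + (comp H v).ncard ≤ q := by
  have key : ∀ u, (H.connectedComponentMk u).supp = comp H u := by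
    intro u; ext z
    simp only [ConnectedComponent.mem_supp_iff, ConnectedComponent.eq, comp, Set.mem_ofPred_eq]
    exact ⟨fun h => h.symm, fun h => h.symm⟩
  unfold inS
  refine and_congr_right fun _ => and_congr_right fun _ => ⟨?_, ?_⟩
  · intro h u v huv
    have := h (H.connectedComponentMk u) (H.connectedComponentMk v)
      (fun h' => huv (ConnectedComponent.eq.1 h'))
    rwa [key, key] at this
  · intro h C D
    refine ConnectedComponent.ind₂ (fun u v => ?_) C D
    intro hne
    rw [key, key]
    exact h u v (fun h' => hne (ConnectedComponent.eq.2 h'))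

lemma connected_iff [Nonempty V] {H : SimpleGraph V} : H.Connected ↔ ∀ u v, H.Reachable u v :=
  ⟨fun h => h.preconnected, fun h => ⟨h⟩⟩

/-- lower bound construction -/
lemma lower {G H : SimpleGraph V} [Nonempty V] {q : ℕ} (hG : G.Connected) (hH : inS G H q) :
    ∃ c : Sym2 V → ℕ, c '' G.edgeSet = Set.Iio (H.edgeSet.ncard + 1) ∧
      ¬ hasRainbowTree G c q := by
  classical
  rw [inS_iff] at hH
  obtain ⟨hle, hnc, hpair⟩ := hH
  have hfin : H.edgeSet.Finite := Set.toFinite _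
  let φ : H.edgeSet ≃ Fin H.edgeSet.ncard := Finite.equivFin H.edgeSet
  let c : Sym2 V → ℕ := fun e => if h : e ∈ H.edgeSet then (φ ⟨e, h⟩ : ℕ) else H.edgeSet.ncard
  have hc1 : ∀ e (h : e ∈ H.edgeSet), c e = φ ⟨e, h⟩ := fun e h => dif_pos h
  have hc2 : ∀ e, e ∉ H.edgeSet → c e = H.edgeSet.ncard := fun e h => dif_neg h
  refine ⟨c, ?_, ?_⟩
  · ext m
    simp only [Set.mem_image, Set.mem_Iio]
    constructor
    · rintro ⟨e, he, rfl⟩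
      by_cases h : e ∈ H.edgeSet
      · rw [hc1 e h]; have := (φ ⟨e, h⟩).2; omega
      · rw [hc2 e h]; omega
    · intro hm
      by_cases hm' : m < H.edgeSet.ncard
      · refine ⟨φ.symm ⟨m, hm'⟩, edgeSet_mono hle (φ.symm ⟨m, hm'⟩).2, ?_⟩
        rw [hc1 _ (φ.symm ⟨m, hm'⟩).2]; simp
      · have : ¬ G.edgeSet ⊆ H.edgeSet := fun h => hnc (hG.mono (edgeSet_subset_edgeSet.1 h))
        obtain ⟨e, he, he'⟩ := Set.not_subset.1 this
        exact ⟨e, he, by rw [hc2 e he']; omega⟩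
  · rintro ⟨T, hT, hq, hinj⟩
    rw [isTree_of] at hT
    obtain ⟨hTc, hcard⟩ := hT
    have hbig : ∃ x y, T.verts ⊆ comp H x ∪ comp H y := by
      by_cases hall : T.edgeSet ⊆ H.edgeSet
      · obtain ⟨v, hv⟩ := hTc.nonempty
        refine ⟨v, v, ?_⟩
        intro z hz
        have h1 := (Subgraph.connected_iff'.1 hTc).preconnected ⟨v, hv⟩ ⟨z, hz⟩
        left
        refine reach_ind (fun z : T.verts => H.Reachable v z) (Reachable.refl v) ?_ h1
        intro p r _ ih hpr
        exact ih.trans (Adj.reachable (hall (show s(p.1, r.1) ∈ T.edgeSet from hpr)))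
      · obtain ⟨e, he, he'⟩ := Set.not_subset.1 hall
        induction e with | _ x y
        have hx : x ∈ T.verts := T.edge_vert he
        refine ⟨x, y, ?_⟩
        intro z hz
        have h1 := (Subgraph.connected_iff'.1 hTc).preconnected ⟨x, hx⟩ ⟨z, hz⟩
        refine reach_ind (fun z : T.verts => z.1 ∈ comp H x ∪ comp H y)
          (Or.inl (mem_comp_self _ _)) ?_ h1
        intro p r _ ih hpr
        have hpr' : s(p.1, r.1) ∈ T.edgeSet := hpr
        by_cases h : s(p.1, r.1) ∈ H.edgeSet
        · rcases ih with ih | ih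
          · exact Or.inl (Reachable.trans ih (Adj.reachable h))
          · exact Or.inr (Reachable.trans ih (Adj.reachable h))
        · have := hinj hpr' he (by rw [hc2 _ h, hc2 _ he'])
          rcases Sym2.eq_iff.1 this with ⟨_, h⟩ | ⟨_, h⟩
          · right; rw [h]; exact mem_comp_self _ _
          · left; rw [h]; exact mem_comp_self _ _
    obtain ⟨x, y, hxy⟩ := hbig
    have h1 := Set.ncard_le_ncard hxy (Set.toFinite _)
    by_cases hr : H.Reachable x y
    · rw [comp_eq hr, Set.union_self] at h1
      have : ∃ z, ¬ H.Reachable y z := by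
        by_contra! hcon
        exact hnc (connected_iff.2 fun u v => (hcon u).symm.trans (hcon v))
      obtain ⟨z, hz⟩ := this
      have := hpair _ _ hz
      omega
    · rw [card_reach_add hr] at h1
      have := hpair _ _ hr
      omega

/-- `R` is a subgraph of `G` with exactly one edge of each color. -/
def Good (G : SimpleGraph V) (c : Sym2 V → ℕ) (R : SimpleGraph V) : Prop :=
  R ≤ G ∧ Set.InjOn c R.edgeSet ∧ c '' R.edgeSet = c '' G.edgeSet

lemma exists_good (G : SimpleGraph V) (c : Sym2 V → ℕ) : ∃ R, Good G c R := by
  obtain ⟨E, hE, hb⟩ := (Set.surjOn_image c G.edgeSet).exists_bijOn_subset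
  have h1 : (fromEdgeSet E).edgeSet = E := by
    rw [edgeSet_fromEdgeSet]
    ext e
    simp only [Set.mem_sdiff, and_iff_left_iff_imp]
    intro he
    exact G.not_isDiag_of_mem_edgeSet (hE he)
  refine ⟨fromEdgeSet E, ?_, ?_, ?_⟩
  · rw [← edgeSet_subset_edgeSet, h1]; exact hE
  · rw [h1]; exact hb.injOn
  · rw [h1]; exact hb.image_eq

lemma swap {G R : SimpleGraph V} {c : Sym2 V → ℕ} (hR : Good G c R) {u w : V} (huw : G.Adj u w)
    (hn : ¬ R.Reachable u w) :
    ∃ x y, R.Adj x y ∧ Good G c (R.deleteEdges {s(x, y)} ⊔ edge u w) := by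
  obtain ⟨h1, h2, h3⟩ := hR
  have : c s(u, w) ∈ c '' R.edgeSet := by rw [h3]; exact ⟨_, huw, rfl⟩
  obtain ⟨f, hf, hcf⟩ := this
  induction f with | _ x y
  have hne : s(u, w) ∉ R.edgeSet := fun h => hn (Adj.reachable h)
  have hE : (R.deleteEdges {s(x, y)} ⊔ edge u w).edgeSet =
      (R.edgeSet \ {s(x, y)}) ∪ {s(u, w)} := by
    rw [edgeSet_sup, edgeSet_deleteEdges, edgeSet_edge_of_ne huw.ne]
  refine ⟨x, y, hf, ?_, ?_, ?_⟩
  · rw [← edgeSet_subset_edgeSet, hE]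
    rintro e (he | he)
    · exact edgeSet_mono h1 he.1
    · rw [Set.mem_singleton_iff.1 he]; exact huw
  · rw [hE]
    rintro e (he | he) e' (he' | he') hee
    · exact h2 he.1 he'.1 hee
    · rw [Set.mem_singleton_iff.1 he', ← hcf] at hee
      exact absurd (h2 he.1 hf hee) he.2
    · rw [Set.mem_singleton_iff.1 he, ← hcf] at hee
      exact absurd (h2 he'.1 hf hee.symm) he'.2
    · rw [Set.mem_singleton_iff.1 he, Set.mem_singleton_iff.1 he']
  · rw [hE, ← h3]
    ext m
    constructor
    · rintro ⟨e, he | he, rfl⟩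
      · exact ⟨e, he.1, rfl⟩
      · rw [Set.mem_singleton_iff.1 he, ← hcf]; exact ⟨_, hf, rfl⟩
    · rintro ⟨e, he, rfl⟩
      by_cases hee : e = s(x, y)
      · exact ⟨s(u, w), Or.inr rfl, by rw [hee, hcf]⟩
      · exact ⟨e, Or.inl ⟨he, hee⟩, rfl⟩

lemma comp_mono {K R : SimpleGraph V} (h : K ≤ R) (v : V) : comp K v ⊆ comp R v :=
  fun _ hz => Reachable.mono h hz

lemma step {G R : SimpleGraph V} {c : Sym2 V → ℕ} (hR : Good G c R) {u w : V} (huw : G.Adj u w)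
    (hn : ¬ R.Reachable u w)
    (hmax : ∀ R', Good G c R' → ∀ v, (comp R' v).ncard ≤ (comp R u).ncard) :
    ∃ x y, R.Adj x y ∧ (R.deleteEdges {s(x, y)}).Reachable u x ∧
      ¬ (R.deleteEdges {s(x, y)}).Reachable u y ∧
      (comp (R.deleteEdges {s(x, y)}) u).ncard + (comp R w).ncard ≤ (comp R u).ncard := by
  obtain ⟨x₀, y₀, hxy₀, hg₀⟩ := swap hR huw hn
  have hsum : ∀ x y, Good G c (R.deleteEdges {s(x, y)} ⊔ edge u w) →
      (comp (R.deleteEdges {s(x, y)}) u).ncard + (comp (R.deleteEdges {s(x, y)}) w).ncard ≤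
        (comp R u).ncard := by
    intro x y hg
    have hKR : R.deleteEdges {s(x, y)} ≤ R := deleteEdges_le _
    have hnK : ¬ (R.deleteEdges {s(x, y)}).Reachable u w := fun h => hn (h.mono hKR)
    rw [← card_reach_add hnK]
    refine le_trans (Set.ncard_le_ncard ?_ (Set.toFinite _)) (hmax _ hg u)
    rintro z (hz | hz)
    · exact Reachable.mono le_sup_left hz
    · have h1 : (R.deleteEdges {s(x, y)} ⊔ edge u w).Adj u w :=
        Or.inr (by rw [edge_adj]; exact ⟨Or.inl ⟨rfl, rfl⟩, huw.ne⟩)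
      exact h1.reachable.trans (Reachable.mono le_sup_left hz)
  have hpos : ∀ K : SimpleGraph V, 0 < (comp K w).ncard := fun K =>
    (Set.ncard_pos (Set.toFinite _)).2 ⟨w, mem_comp_self K w⟩
  have hnsub : ∀ x y, Good G c (R.deleteEdges {s(x, y)} ⊔ edge u w) →
      ¬ comp R u ⊆ comp (R.deleteEdges {s(x, y)}) u := by
    intro x y hg hsub
    have := Set.ncard_le_ncard hsub (Set.toFinite _)
    have h1 := hsum x y hg
    have h2 := hpos (R.deleteEdges {s(x, y)})
    omega
  have : ∃ x y, R.Adj x y ∧ Good G c (R.deleteEdges {s(x, y)} ⊔ edge u w) ∧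
      (R.deleteEdges {s(x, y)}).Reachable u x := by
    by_cases hx : (R.deleteEdges {s(x₀, y₀)}).Reachable u x₀
    · exact ⟨x₀, y₀, hxy₀, hg₀, hx⟩
    by_cases hy : (R.deleteEdges {s(x₀, y₀)}).Reachable u y₀
    · refine ⟨y₀, x₀, hxy₀.symm, ?_, ?_⟩
      · rw [Sym2.eq_swap]; exact hg₀
      · rw [Sym2.eq_swap]; exact hy
    exfalso
    apply hnsub _ _ hg₀
    intro z hz
    refine reach_ind (fun z => (R.deleteEdges {s(x₀, y₀)}).Reachable u z)
      (Reachable.refl u) ?_ hz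
    intro p r _ ih hpr
    refine ih.trans (Adj.reachable ?_)
    rw [deleteEdges_adj]
    refine ⟨hpr, fun he => ?_⟩
    rcases Sym2.eq_iff.1 he with ⟨rfl, rfl⟩ | ⟨rfl, rfl⟩
    · exact hx ih
    · exact hy ih
  obtain ⟨x, y, hxy, hg, hx⟩ := this
  refine ⟨x, y, hxy, hx, ?_, ?_⟩
  · intro hy
    apply hnsub _ _ hg
    intro z hz
    rcases del_reach (x := x) (y := y) hz with h | h | h
    · exact h
    · exact hx.trans h
    · exact hy.trans h
  · refine le_trans (Nat.add_le_add_left (Set.ncard_le_ncard ?_ (Set.toFinite _)) _) (hsum x y hg)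
    intro z hz
    refine transfer hz ?_
    intro p r hp hpr
    rw [deleteEdges_adj]
    refine ⟨hpr, fun he => hn ?_⟩
    have hRx : R.Reachable u x := hx.mono (deleteEdges_le _)
    rcases Sym2.eq_iff.1 he with ⟨rfl, rfl⟩ | ⟨rfl, rfl⟩
    · exact hRx.trans hp.symm
    · exact (hRx.trans hxy.reachable).trans hp.symm

lemma exists_nbr {R : SimpleGraph V} {v : V} (h : 2 ≤ (comp R v).ncard) : ∃ r, R.Adj v r := by
  by_contra! hcon
  have : comp R v ⊆ {v} := by
    intro z hz
    refine reach_ind (fun z => z ∈ ({v} : Set V)) rfl ?_ hz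
    intro p r _ hp hpr
    rw [Set.mem_singleton_iff] at hp
    subst hp
    exact absurd hpr (hcon r)
  have := Set.ncard_le_ncard this (Set.toFinite _)
  rw [Set.ncard_singleton] at this
  omega

/-- Sizes of the two sides of a bridge. -/
lemma two_sides {R : SimpleGraph V} {a x y : V} (hxy : R.Adj x y) (hax : R.Reachable a x)
    (hn : ¬ (R.deleteEdges {s(x, y)}).Reachable x y) :
    (comp (R.deleteEdges {s(x, y)}) x).ncard + (comp (R.deleteEdges {s(x, y)}) y).ncard =
      (comp R a).ncard := by
  rw [← card_reach_add hn]
  congr 1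
  have hle : R.deleteEdges {s(x, y)} ≤ R := deleteEdges_le _
  ext z
  constructor
  · rintro (h | h)
    · exact hax.trans (Reachable.mono hle h)
    · exact (hax.trans hxy.reachable).trans (Reachable.mono hle h)
  · intro h
    have h' : R.Reachable x z := hax.symm.trans h
    rcases del_reach (x := x) (y := y) h' with h | h | h
    · exact Or.inl h
    · exact Or.inl h
    · exact Or.inr h

lemma bridge {G R : SimpleGraph V} {c : Sym2 V → ℕ} {q : ℕ} (hq2 : 2 ≤ q)
    (hG : ∀ x y z, G.Adj x y → G.Adj z x ∨ G.Adj z y)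
    (hR : Good G c R) {a b : V} (hab : ¬ R.Reachable a b)
    (hmax : ∀ R', Good G c R' → ∀ v, (comp R' v).ncard ≤ (comp R a).ncard)
    (haq : (comp R a).ncard ≤ q) (hlarge : q < (comp R a).ncard + (comp R b).ncard) :
    ∃ x y, R.Adj x y ∧ R.Reachable a x ∧ ¬ (R.deleteEdges {s(x, y)}).Reachable x y ∧
      (comp (R.deleteEdges {s(x, y)}) x).ncard + (comp R b).ncard ≤ q ∧
      (comp (R.deleteEdges {s(x, y)}) y).ncard + (comp R b).ncard ≤ q ∧
      2 * (comp R b).ncard ≤ q := by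
  have hba : (comp R b).ncard ≤ (comp R a).ncard := hmax R hR b
  have hpos : ∀ (K : SimpleGraph V) w, 0 < (comp K w).ncard := fun K w =>
    (Set.ncard_pos (Set.toFinite _)).2 ⟨w, mem_comp_self K w⟩
  have hstep : ∀ u w, R.Reachable a u → R.Reachable b w → G.Adj u w →
      ∃ x y, R.Adj x y ∧ (R.deleteEdges {s(x, y)}).Reachable u x ∧
      ¬ (R.deleteEdges {s(x, y)}).Reachable u y ∧
      (comp (R.deleteEdges {s(x, y)}) u).ncard + (comp R b).ncard ≤ (comp R a).ncard := by
    intro u w hu hw huw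
    have h1 : ¬ R.Reachable u w := fun h => hab ((hu.trans h).trans hw.symm)
    have := step hR huw h1 (by rw [← comp_eq hu]; exact hmax)
    rwa [← comp_eq hu, ← comp_eq hw] at this
  by_cases hb1 : (comp R b).ncard = 1
  · obtain ⟨r, hr⟩ := exists_nbr (R := R) (v := a) (by omega)
    have : ∃ u, R.Reachable a u ∧ G.Adj u b := by
      rcases hG a r b (hR.1 hr) with h | h
      · exact ⟨a, Reachable.refl a, h.symm⟩
      · exact ⟨r, hr.reachable, h.symm⟩
    obtain ⟨u, hu, hub⟩ := this
    obtain ⟨x, y, hxy, hx, hy, hs⟩ := hstep u b hu (Reachable.refl b) hub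
    have hax : R.Reachable a x := hu.trans (hx.mono (deleteEdges_le _))
    have hnxy : ¬ (R.deleteEdges {s(x, y)}).Reachable x y := fun h => hy (hx.trans h)
    have h2 := two_sides hxy hax hnxy
    have h3 := hpos (R.deleteEdges {s(x, y)}) x
    have h4 := hpos (R.deleteEdges {s(x, y)}) y
    exact ⟨x, y, hxy, hax, hnxy, by omega, by omega, by omega⟩
  · have hb2 : 2 ≤ (comp R b).ncard := by have := hpos R b; omega
    obtain ⟨r, hr⟩ := exists_nbr hb2
    have hall : ∀ u, R.Reachable a u → ∃ x y, R.Adj x y ∧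
        (R.deleteEdges {s(x, y)}).Reachable u x ∧
        ¬ (R.deleteEdges {s(x, y)}).Reachable u y ∧
        (comp (R.deleteEdges {s(x, y)}) u).ncard + (comp R b).ncard ≤ (comp R a).ncard := by
      intro u hu
      rcases hG b r u (hR.1 hr) with h | h
      · exact hstep u b hu (Reachable.refl b) h
      · exact hstep u r hu hr.reachable h
    let S : Set ℕ := {m | ∃ u x y, R.Reachable a u ∧ R.Adj x y ∧
        (R.deleteEdges {s(x, y)}).Reachable u x ∧
        ¬ (R.deleteEdges {s(x, y)}).Reachable u y ∧
        (comp (R.deleteEdges {s(x, y)}) u).ncard + (comp R b).ncard ≤ (comp R a).ncard ∧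
        (comp (R.deleteEdges {s(x, y)}) u).ncard = m}
    have hSne : S.Nonempty := by
      obtain ⟨x, y, h⟩ := hall a (Reachable.refl a)
      exact ⟨_, a, x, y, Reachable.refl a, h.1, h.2.1, h.2.2.1, h.2.2.2, rfl⟩
    have hSbd : BddAbove S := by
      refine ⟨(comp R a).ncard, ?_⟩
      rintro m ⟨u, x, y, -, -, -, -, h, rfl⟩
      omega
    obtain ⟨u, x, y, hu, hxy, hx, hy, hs, hm⟩ := Nat.sSup_mem hSne hSbd
    have hax : R.Reachable a x := hu.trans (hx.mono (deleteEdges_le _))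
    have hnxy : ¬ (R.deleteEdges {s(x, y)}).Reachable x y := fun h => hy (hx.trans h)
    have h2 := two_sides hxy hax hnxy
    have hux := comp_eq hx
    rw [hux] at hs hm
    suffices hgoal : (comp (R.deleteEdges {s(x, y)}) y).ncard + (comp R b).ncard ≤ q from
      ⟨x, y, hxy, hax, hnxy, by omega, hgoal, by omega⟩
    have hay : R.Reachable a y := hax.trans hxy.reachable
    obtain ⟨x', y', hxy', hx', hy', hs'⟩ := hall y hay
    have hle' : (comp (R.deleteEdges {s(x', y')}) y).ncard ≤ sSup S :=
      le_csSup hSbd ⟨y, x', y', hay, hxy', hx', hy', hs', rfl⟩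
    have hfin : (∀ z, (R.deleteEdges {s(x, y)}).Reachable y z →
        (R.deleteEdges {s(x', y')}).Reachable y z) →
        (comp (R.deleteEdges {s(x, y)}) y).ncard + (comp R b).ncard ≤ q := by
      intro h
      have : (comp (R.deleteEdges {s(x, y)}) y).ncard ≤
          (comp (R.deleteEdges {s(x', y')}) y).ncard :=
        Set.ncard_le_ncard h (Set.toFinite _)
      omega
    by_cases hff : s(x', y') = s(x, y)
    · apply hfin; intro z hz; rw [hff]; exact hz
    have hKxy' : (R.deleteEdges {s(x, y)}).Adj x' y' := by
      rw [deleteEdges_adj]; exact ⟨hxy', hff⟩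
    by_cases hin : (R.deleteEdges {s(x, y)}).Reachable x x'
    · apply hfin
      intro z hz
      refine transfer hz ?_
      intro p r hp hpr
      rw [deleteEdges_adj]
      refine ⟨(deleteEdges_le _) hpr, fun he => hnxy ?_⟩
      rcases Sym2.eq_iff.1 he with ⟨rfl, rfl⟩ | ⟨rfl, rfl⟩
      · exact hin.trans hp.symm
      · exact (hin.trans hKxy'.reachable).trans hp.symm
    · exfalso
      have hyx : (R.deleteEdges {s(x', y')}).Reachable y x := by
        refine Adj.reachable ?_
        rw [deleteEdges_adj]
        refine ⟨hxy.symm, fun he => hff ?_⟩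
        rw [← Set.mem_singleton_iff.1 he, Sym2.eq_swap]
      have hsub : insert y (comp (R.deleteEdges {s(x, y)}) x) ⊆
          comp (R.deleteEdges {s(x', y')}) y := by
        intro z hz
        rcases hz with rfl | hz
        · exact mem_comp_self _ _
        refine hyx.trans (transfer hz ?_)
        intro p r hp hpr
        rw [deleteEdges_adj]
        refine ⟨(deleteEdges_le _) hpr, fun he => hin ?_⟩
        rcases Sym2.eq_iff.1 he with ⟨rfl, rfl⟩ | ⟨rfl, rfl⟩
        · exact hp
        · exact hp.trans hKxy'.symm.reachable
      have h5 := Set.ncard_le_ncard hsub (Set.toFinite _)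
      rw [Set.ncard_insert_of_notMem (show y ∉ comp (R.deleteEdges {s(x, y)}) x from hnxy)
        (Set.toFinite _)] at h5
      omega

lemma upper {G : SimpleGraph V} {c : Sym2 V → ℕ} {q t : ℕ} [Nonempty V] (hq2 : 2 ≤ q)
    (hq : q + 1 ≤ Fintype.card V)
    (hG : ∀ x y z, G.Adj x y → G.Adj z x ∨ G.Adj z y)
    (hc : c '' G.edgeSet = Set.Iio t) (hn : ¬ hasRainbowTree G c q) :
    ∃ H, inS G H q ∧ t ≤ H.edgeSet.ncard + 1 := by
  let S : Set ℕ := {m | ∃ R a, Good G c R ∧ (comp R a).ncard = m}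
  have hSne : S.Nonempty := by
    obtain ⟨R, hR⟩ := exists_good G c
    exact ⟨_, R, Classical.arbitrary V, hR, rfl⟩
  have hSbd : BddAbove S := by
    refine ⟨q, ?_⟩
    rintro m ⟨R, a, hR, rfl⟩
    exact comp_le hR.1 hR.2.1 hn a
  obtain ⟨R, a, hR, hm⟩ := Nat.sSup_mem hSne hSbd
  have hmax : ∀ R', Good G c R' → ∀ v, (comp R' v).ncard ≤ (comp R a).ncard := by
    intro R' hR' v
    rw [hm]; exact le_csSup hSbd ⟨R', v, hR', rfl⟩
  have haq := comp_le hR.1 hR.2.1 hn a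
  have hRt : R.edgeSet.ncard = t := by
    rw [← Set.InjOn.ncard_image hR.2.1, hR.2.2, hc]
    rw [← Finset.coe_Iio, Set.ncard_coe_finset, Nat.card_Iio]
  have hout : ∃ v, ¬ R.Reachable a v := by
    by_contra! hcon
    have : comp R a = Set.univ := Set.eq_univ_of_forall hcon
    rw [this, Set.ncard_univ, Nat.card_eq_fintype_card] at haq
    omega
  have hRnc : ¬ R.Connected := fun h => by
    obtain ⟨v, hv⟩ := hout
    exact hv (h.preconnected a v)
  let S2 : Set ℕ := {m | ∃ v, ¬ R.Reachable a v ∧ (comp R v).ncard = m}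
  have hS2ne : S2.Nonempty := by
    obtain ⟨v, hv⟩ := hout
    exact ⟨_, v, hv, rfl⟩
  have hS2bd : BddAbove S2 := by
    refine ⟨q, ?_⟩
    rintro m ⟨v, -, rfl⟩
    exact comp_le hR.1 hR.2.1 hn v
  obtain ⟨b, hab, hbm⟩ := Nat.sSup_mem hS2ne hS2bd
  have hbmax : ∀ v, ¬ R.Reachable a v → (comp R v).ncard ≤ (comp R b).ncard := by
    intro v hv
    rw [hbm]; exact le_csSup hS2bd ⟨v, hv, rfl⟩
  have hba := hmax R hR b
  by_cases hlarge : (comp R a).ncard + (comp R b).ncard ≤ q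
  · refine ⟨R, inS_iff.2 ⟨hR.1, hRnc, ?_⟩, by omega⟩
    intro u v huv
    by_cases hu : R.Reachable a u
    · have hv : ¬ R.Reachable a v := fun h => huv (hu.symm.trans h)
      have := hbmax v hv
      rw [← comp_eq hu]; omega
    · have := hbmax u hu
      have := hmax R hR v
      omega
  · obtain ⟨x, y, hxy, hax, hnxy, hx, hy, h2b⟩ :=
      bridge hq2 hG hR hab hmax haq (by omega)
    have hle : R.deleteEdges {s(x, y)} ≤ R := deleteEdges_le _
    have hts := two_sides hxy hax hnxy
    refine ⟨R.deleteEdges {s(x, y)}, inS_iff.2 ⟨hle.trans hR.1, fun h => hRnc (h.mono hle), ?_⟩, ?_⟩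
    · have hin : ∀ u, R.Reachable a u → (R.deleteEdges {s(x, y)}).Reachable x u ∨
          (R.deleteEdges {s(x, y)}).Reachable y u := by
        intro u hu
        rcases del_reach (x := x) (y := y) (hax.symm.trans hu) with h | h | h
        · exact Or.inl h
        · exact Or.inl h
        · exact Or.inr h
      have hsz : ∀ u, ¬ R.Reachable a u →
          (comp (R.deleteEdges {s(x, y)}) u).ncard ≤ (comp R b).ncard := fun u hu =>
        le_trans (Set.ncard_le_ncard (comp_mono hle u) (Set.toFinite _)) (hbmax u hu)
      have hsz' : ∀ u, R.Reachable a u →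
          (comp (R.deleteEdges {s(x, y)}) u).ncard + (comp R b).ncard ≤ q := by
        intro u hu
        rcases hin u hu with h | h
        · rw [← comp_eq h]; exact hx
        · rw [← comp_eq h]; exact hy
      intro u v huv
      by_cases hu : R.Reachable a u <;> by_cases hv : R.Reachable a v
      · rcases hin u hu with h | h <;> rcases hin v hv with h' | h'
        · exact absurd (h.symm.trans h') huv
        · rw [← comp_eq h, ← comp_eq h']; omega
        · rw [← comp_eq h, ← comp_eq h']; omega
        · exact absurd (h.symm.trans h') huv
      · have := hsz v hv; have := hsz' u hu; omega
      · have := hsz u hu; have := hsz' v hv; omega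
      · have := hsz u hu; have := hsz v hv; omega
    · rw [edgeSet_deleteEdges, Set.ncard_sdiff_singleton_of_mem (show s(x, y) ∈ R.edgeSet from hxy)]
      omega

lemma main {G : SimpleGraph V} {q : ℕ} [Nonempty V] (hq2 : 2 ≤ q)
    (hq : q + 1 ≤ Fintype.card V) (hconn : G.Connected)
    (hG : ∀ x y z, G.Adj x y → G.Adj z x ∨ G.Adj z y) :
    ar G q = ell G q + 1 := by
  have hEne : {m | ∃ H : SimpleGraph V, inS G H q ∧ H.edgeSet.ncard = m}.Nonempty := by
    refine ⟨_, ⊥, inS_iff.2 ⟨bot_le, ?_, ?_⟩, rfl⟩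
    · intro h
      have h1 : Fintype.card V ≤ 1 := by
        rw [Fintype.card_le_one_iff]
        intro u v
        exact reachable_bot.1 (h.preconnected u v)
      omega
    · intro u v _
      have : ∀ w : V, comp (⊥ : SimpleGraph V) w = {w} := by
        intro w; ext z
        exact ⟨fun h => (reachable_bot.1 h).symm, fun h => reachable_bot.2 h.symm⟩
      rw [this, this, Set.ncard_singleton, Set.ncard_singleton]; exact hq2
  have hEbd : BddAbove {m | ∃ H : SimpleGraph V, inS G H q ∧ H.edgeSet.ncard = m} := by
    refine ⟨G.edgeSet.ncard, ?_⟩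
    rintro m ⟨H, hH, rfl⟩
    exact Set.ncard_le_ncard (edgeSet_mono hH.1) (Set.toFinite _)
  obtain ⟨H, hH, hHm⟩ := Nat.sSup_mem hEne hEbd
  have hmem : ell G q + 1 ∈
      {t | ∃ c : Sym2 V → ℕ, c '' G.edgeSet = Set.Iio t ∧ ¬ hasRainbowTree G c q} := by
    have := lower hconn hH
    rw [hHm] at this
    exact this
  have hub : ∀ t ∈ {t | ∃ c : Sym2 V → ℕ, c '' G.edgeSet = Set.Iio t ∧ ¬ hasRainbowTree G c q},
      t ≤ ell G q + 1 := by
    rintro t ⟨c, hc, hn⟩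
    obtain ⟨H', hH', ht⟩ := upper hq2 hq hG hc hn
    have : H'.edgeSet.ncard ≤ ell G q := le_csSup hEbd ⟨H', hH', rfl⟩
    omega
  exact le_antisymm (csSup_le ⟨_, hmem⟩ hub) (le_csSup ⟨_, hub⟩ hmem)

end AR

/-- For `k ≥ 2` and `2 ≤ q ≤ p₁ + ⋯ + p_k − 1`,
`ar(K_{p₁,…,p_k}, 𝒯_q) = ℓ_q(K_{p₁,…,p_k}) + 1`. -/
theorem stmt3 (k : ℕ) (hk : 2 ≤ k) (p : Fin k → ℕ) (hp : ∀ i, 1 ≤ p i)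
    (q : ℕ) (hq2 : 2 ≤ q) (hq : q ≤ (∑ i, p i) - 1) :
    ar (completeMultipartiteGraph fun i : Fin k => Fin (p i)) q =
      ell (completeMultipartiteGraph fun i : Fin k => Fin (p i)) q + 1 := by
  have hG : ∀ x y z, (completeMultipartiteGraph fun i : Fin k => Fin (p i)).Adj x y →
      (completeMultipartiteGraph fun i : Fin k => Fin (p i)).Adj z x ∨
      (completeMultipartiteGraph fun i : Fin k => Fin (p i)).Adj z y := by
    intro x y z h
    simp only [comap_adj, top_adj] at h ⊢
    by_contra! hcon
    exact h (hcon.1.symm.trans hcon.2)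
  let x : Σ i : Fin k, Fin (p i) := ⟨⟨0, by omega⟩, ⟨0, hp _⟩⟩
  let y : Σ i : Fin k, Fin (p i) := ⟨⟨1, by omega⟩, ⟨0, hp _⟩⟩
  have hxy : (completeMultipartiteGraph fun i : Fin k => Fin (p i)).Adj x y := by
    simp [x, y]
  have : Nonempty (Σ i : Fin k, Fin (p i)) := ⟨x⟩
  refine AR.main hq2 ?_ ?_ hG
  · rw [Fintype.card_sigma]
    simp only [Fintype.card_fin]
    omega
  · have hx : ∀ z, (completeMultipartiteGraph fun i : Fin k => Fin (p i)).Reachable x z := by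
      intro z
      rcases hG x y z hxy with h | h
      · exact h.symm.reachable
      · exact hxy.reachable.trans h.symm.reachable
    exact AR.connected_iff.2 fun u v => (hx u).symm.trans (hx v)
end

section
/- Let G be the complete multi-partite graph K_{p₁,…,p_k} of order n = p₁+⋯+p_k with k ≥ 2, and let n−3 ≤ q ≤ n−1 with q ≥ 2. If (G, q) is not one of (K_{3,3},4), (K_{4,3},4), (K_{3,3,3},6), then ℓ_q(G) = |E(G)| − min over (n−q+1)-element subsets S of V(G) of |E_G(S)|. -/
open SimpleGraph

variable {V : Type} [Fintype V]

/-- `E_G(S)`: the set of edges of `G` incident with at least one vertex of `S`. -/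
def incE (G : SimpleGraph V) (S : Finset V) : Set (Sym2 V) :=
  {e ∈ G.edgeSet | ∃ v ∈ S, v ∈ e}


open Classical in
def inE (G : SimpleGraph V) (T : Finset V) : Set (Sym2 V) :=
  {e ∈ G.edgeSet | ∀ v ∈ e, v ∈ T}

noncomputable def eN (G : SimpleGraph V) (T : Finset V) : ℕ := (inE G T).ncard

noncomputable def MM (G : SimpleGraph V) (t : ℕ) : ℕ :=
  (Finset.powersetCard t (Finset.univ : Finset V)).sup (eN G)

open Classical in
theorem eN_insert {k : ℕ} (G : SimpleGraph V) (col : V → Fin k)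
    (hG : ∀ u v, G.Adj u v ↔ col u ≠ col v) (v : V) (T : Finset V) (hv : v ∉ T) :
    eN G (insert v T) = eN G T + (T.filter (fun u => col u ≠ col v)).card := by
  have h1 : inE G (insert v T) = inE G T ∪
      (((T.filter (fun u => col u ≠ col v)).image (fun u => s(v, u)) : Finset (Sym2 V)) :
        Set (Sym2 V)) := by
    ext e
    induction e using Sym2.ind with
    | _ x y =>
      simp only [inE, Set.mem_ofPred_eq, mem_edgeSet, hG, Sym2.mem_iff, Finset.mem_insert,
        forall_eq_or_imp, forall_eq, Set.mem_union, Finset.coe_image, Set.mem_image,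
        Finset.coe_filter, Sym2.eq_iff]
      constructor
      · rintro ⟨hne, hx | hx, hy | hy⟩
        · subst hx; subst hy; exact absurd rfl hne
        · subst hx
          exact Or.inr ⟨y, ⟨hy, fun h => hne h.symm⟩, Or.inl ⟨rfl, rfl⟩⟩
        · subst hy
          exact Or.inr ⟨x, ⟨hx, hne⟩, Or.inr ⟨rfl, rfl⟩⟩
        · exact Or.inl ⟨hne, hx, hy⟩
      · rintro (⟨hne, hx, hy⟩ | ⟨u, ⟨hu, hne⟩, ⟨rfl, rfl⟩ | ⟨rfl, rfl⟩⟩)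
        · exact ⟨hne, Or.inr hx, Or.inr hy⟩
        · exact ⟨fun h => hne h.symm, Or.inl rfl, Or.inr hu⟩
        · exact ⟨hne, Or.inr hu, Or.inl rfl⟩
  unfold eN
  rw [h1, Set.ncard_union_eq _ (Set.toFinite _) (Set.toFinite _), Set.ncard_coe_finset,
    Finset.card_image_of_injective]
  · intro a b h
    have h : s(v, a) = s(v, b) := h
    rw [Sym2.eq_iff] at h
    rcases h with h | h
    · exact h.2
    · rw [h.2, ← h.1]
  · rw [Set.disjoint_left]
    intro e he he'
    simp only [Finset.coe_image, Set.mem_image, Finset.coe_filter, Set.mem_ofPred_eq] at he'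
    obtain ⟨u, _, rfl⟩ := he'
    exact hv (he.2 v (by simp))

theorem eN_empty (G : SimpleGraph V) : eN G ∅ = 0 := by
  unfold eN
  rw [Set.ncard_eq_zero]
  ext e
  induction e using Sym2.ind with
  | _ x y => simp [inE]; exact fun _ => ⟨x, fun h => absurd rfl h⟩

theorem eN_le_MM (G : SimpleGraph V) (T : Finset V) : eN G T ≤ MM G T.card :=
  Finset.le_sup (f := eN G) (by simp [Finset.mem_powersetCard])

theorem MM_attained (G : SimpleGraph V) (t : ℕ) (ht : t ≤ Fintype.card V) :
    ∃ T : Finset V, T.card = t ∧ eN G T = MM G t := by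
  obtain ⟨T, hT, h⟩ := Finset.exists_mem_eq_sup (Finset.powersetCard t (Finset.univ : Finset V))
    (Finset.powersetCard_nonempty.2 (by simpa using ht)) (eN G)
  exact ⟨T, (Finset.mem_powersetCard.1 hT).2, h.symm⟩

open Classical in
theorem eN_le_choose {k : ℕ} (G : SimpleGraph V) (col : V → Fin k)
    (hG : ∀ u v, G.Adj u v ↔ col u ≠ col v) (T : Finset V) :
    eN G T ≤ T.card.choose 2 := by
  induction T using Finset.induction_on with
  | empty => simp [eN_empty]
  | insert v T hv ih =>
    rw [eN_insert G col hG v T hv, Finset.card_insert_of_notMem hv, Nat.choose_succ_succ' T.card 1,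
      Nat.choose_one_right]
    have := Finset.card_filter_le T (fun u => col u ≠ col v)
    simp only [Nat.reduceAdd]
    omega

theorem MM_le_choose {k : ℕ} (G : SimpleGraph V) (col : V → Fin k)
    (hG : ∀ u v, G.Adj u v ↔ col u ≠ col v) (t : ℕ) :
    MM G t ≤ t.choose 2 := by
  unfold MM
  apply Finset.sup_le
  intro T hT
  rw [← (Finset.mem_powersetCard.1 hT).2]
  exact eN_le_choose G col hG T

open Classical in
theorem MM_conv {k : ℕ} (G : SimpleGraph V) (col : V → Fin k)
    (hG : ∀ u v, G.Adj u v ↔ col u ≠ col v) (t : ℕ) (ht : t + 2 ≤ Fintype.card V) :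
    2 * MM G (t + 1) ≤ MM G (t + 2) + MM G t := by
  obtain ⟨A, hA, hAe⟩ := MM_attained G (t + 1) (by omega)
  obtain ⟨v, hv⟩ : ∃ v, v ∉ A := by
    by_contra! h
    have : A = Finset.univ := Finset.eq_univ_iff_forall.2 h
    rw [this, Finset.card_univ] at hA
    omega
  have key : ∃ u ∈ A, (A.filter (fun w => col w ≠ col u)).card ≤
      (A.filter (fun w => col w ≠ col v)).card := by
    by_cases h : ∃ u ∈ A, col u = col v
    · obtain ⟨u, hu, huv⟩ := h
      exact ⟨u, hu, by rw [huv]⟩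
    · push Not at h
      obtain ⟨u, hu⟩ : A.Nonempty := by
        rw [← Finset.card_pos]; omega
      refine ⟨u, hu, Finset.card_le_card ?_⟩
      intro w hw
      simp only [Finset.mem_filter] at hw ⊢
      exact ⟨hw.1, h w hw.1⟩
  obtain ⟨u, hu, huv⟩ := key
  have e1 := eN_insert G col hG v A hv
  have e2 := eN_insert G col hG u (A.erase u) (Finset.notMem_erase u A)
  rw [Finset.insert_erase hu] at e2
  have e3 : (A.erase u).filter (fun w => col w ≠ col u) = A.filter (fun w => col w ≠ col u) := by
    ext w
    simp only [Finset.mem_filter, Finset.mem_erase]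
    constructor
    · rintro ⟨⟨_, a⟩, b⟩; exact ⟨a, b⟩
    · rintro ⟨a, b⟩; exact ⟨⟨fun h => b (by rw [h]), a⟩, b⟩
  rw [e3] at e2
  have f1 := eN_le_MM G (insert v A)
  have f2 := eN_le_MM G (A.erase u)
  rw [Finset.card_insert_of_notMem hv, hA] at f1
  rw [Finset.card_erase_of_mem hu, hA] at f2
  simp only [Nat.add_sub_cancel] at f2
  have : t + 1 + 1 = t + 2 := rfl
  rw [this] at f1
  omega

section numeric

theorem incr_mono (M : ℕ → ℕ) (n : ℕ) (h : ∀ t, t + 2 ≤ n → 2 * M (t + 1) ≤ M (t + 2) + M t)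
    (i j : ℕ) (hj : i + j + 1 ≤ n) : M (i + 1) + M (i + j) ≤ M (i + j + 1) + M i := by
  induction j with
  | zero => simp
  | succ j ih =>
    have := ih (by omega)
    have h2 := h (i + j) (by omega)
    have e1 : i + (j + 1) = i + j + 1 := by omega
    have e2 : i + j + 1 + 1 = i + j + 2 := by omega
    rw [e1, e2]
    omega

theorem transfer (M : ℕ → ℕ) (n : ℕ) (h : ∀ t, t + 2 ≤ n → 2 * M (t + 1) ≤ M (t + 2) + M t)
    (x a j : ℕ) (hx : x ≤ a) (hj : a + j ≤ n) : M a + M (x + j) ≤ M (a + j) + M x := by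
  induction j with
  | zero => simp
  | succ j ih =>
    have := ih (by omega)
    obtain ⟨d, rfl⟩ := Nat.exists_eq_add_of_le hx
    have h2 := incr_mono M n h (x + j) d (by omega)
    have e1 : x + j + d = x + d + j := by omega
    rw [e1] at h2
    rw [← add_assoc, ← add_assoc]
    omega

theorem transfer2 (M : ℕ → ℕ) (n : ℕ) (h : ∀ t, t + 2 ≤ n → 2 * M (t + 1) ≤ M (t + 2) + M t)
    (x a b s : ℕ) (ha : x ≤ a) (hb : x ≤ b) (hs : a + b = s + x) (hn : s ≤ n) :
    M a + M b ≤ M s + M x := by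
  obtain ⟨j, rfl⟩ := Nat.exists_eq_add_of_le hb
  have := transfer M n h x a j ha (by omega)
  have e : s = a + j := by omega
  rw [e]; exact this

theorem transfer3 (M : ℕ → ℕ) (n : ℕ) (h : ∀ t, t + 2 ≤ n → 2 * M (t + 1) ≤ M (t + 2) + M t)
    (x a b c s : ℕ) (ha : x ≤ a) (hb : x ≤ b) (hc : x ≤ c) (hs : a + b + c = s + 2 * x)
    (hn : s ≤ n) : M a + M b + M c ≤ M s + 2 * M x := by
  have h1 := transfer2 M n h x a b (a + b - x) ha hb (by omega) (by omega)
  have h2 := transfer2 M n h x (a + b - x) c s (by omega) hc (by omega) (by omega)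
  omega

theorem M_mono (M : ℕ → ℕ) (n : ℕ) (h : ∀ t, t + 2 ≤ n → 2 * M (t + 1) ≤ M (t + 2) + M t)
    (h0 : M 0 = 0) (s t : ℕ) (hst : s ≤ t) (ht : t ≤ n) : M s ≤ M t := by
  have := transfer2 M n h 0 s (t - s) t (by omega) (by omega) (by omega) (by omega)
  omega

theorem sum_super {ι : Type*} (M : ℕ → ℕ) (n : ℕ)
    (h : ∀ t, t + 2 ≤ n → 2 * M (t + 1) ≤ M (t + 2) + M t)
    (h1 : M 1 = 0) (c : ι → ℕ) (hc : ∀ i, 1 ≤ c i) (s : Finset ι)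
    (hs : 1 + ∑ i ∈ s, (c i - 1) ≤ n) : ∑ i ∈ s, M (c i) ≤ M (1 + ∑ i ∈ s, (c i - 1)) := by
  classical
  induction s using Finset.induction_on with
  | empty => simp
  | insert a s ha ih =>
    rw [Finset.sum_insert ha] at hs ⊢
    rw [Finset.sum_insert ha]
    have := ih (by omega)
    have hca := hc a
    have := transfer2 M n h 1 (c a) (1 + ∑ i ∈ s, (c i - 1)) (1 + (c a - 1 + ∑ i ∈ s, (c i - 1)))
      hca (by omega) (by omega) hs
    omega

end numeric

section small

variable {k : ℕ} (G : SimpleGraph V) (col : V → Fin k)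

theorem MM_three (hG : ∀ u v, G.Adj u v ↔ col u ≠ col v) (x y z : V)
    (hxy : col x ≠ col y) (hxz : col x ≠ col z) (hyz : col y ≠ col z) : 3 ≤ MM G 3 := by
  classical
  have nxy : x ≠ y := fun h => hxy (by rw [h])
  have nxz : x ≠ z := fun h => hxz (by rw [h])
  have nyz : y ≠ z := fun h => hyz (by rw [h])
  have h := eN_le_MM G {x, y, z}
  have hc : ({x, y, z} : Finset V).card = 3 := by
    simp [nxy, nxz, nyz]
  rw [hc, eN_insert G col hG x _ (by simp [nxy, nxz]), eN_insert G col hG y _ (by simp [nyz]),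
    ← insert_empty_eq z, eN_insert G col hG z _ (by simp)] at h
  simp [Finset.filter_insert, Finset.filter_singleton, hxy.symm, hxz.symm, hyz.symm, nyz] at h
  omega

theorem tri_inj (hG : ∀ u v, G.Adj u v ↔ col u ≠ col v) (T : Finset V) (hT : T.card = 3)
    (he : 3 ≤ eN G T) : Set.InjOn col T := by
  classical
  intro x hx y hy hxy
  by_contra hne
  have h1 := eN_insert G col hG x (T.erase x) (Finset.notMem_erase x T)
  rw [Finset.insert_erase hx] at h1
  have h2 := eN_le_choose G col hG (T.erase x)
  rw [Finset.card_erase_of_mem hx, hT] at h2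
  have h3 : ((T.erase x).filter (fun u => col u ≠ col x)).card ≤ ((T.erase x).erase y).card := by
    apply Finset.card_le_card
    intro w hw
    simp only [Finset.mem_filter, Finset.mem_erase] at hw ⊢
    exact ⟨fun h => hw.2 (by rw [h, hxy]), hw.1⟩
  rw [Finset.card_erase_of_mem (Finset.mem_erase.2 ⟨fun h => hne h.symm, hy⟩),
    Finset.card_erase_of_mem hx, hT] at h3
  have h4 : (3 - 1).choose 2 = 1 := rfl
  rw [h4] at h2
  omega

theorem MM_four (hG : ∀ u v, G.Adj u v ↔ col u ≠ col v) (x y z w : V)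
    (hxy : col x ≠ col y) (hzw : col z ≠ col w) (nxz : x ≠ z) (nxw : x ≠ w) (nyz : y ≠ z)
    (nyw : y ≠ w) : 4 ≤ MM G 4 := by
  classical
  have nxy : x ≠ y := fun h => hxy (by rw [h])
  have nzw : z ≠ w := fun h => hzw (by rw [h])
  have h := eN_le_MM G {x, y, z, w}
  have hc : ({x, y, z, w} : Finset V).card = 4 := by
    simp [nxy, nxz, nyz, nxw, nyw, nzw]
  rw [hc, eN_insert G col hG x _ (by simp [nxy, nxz, nxw]),
    eN_insert G col hG y _ (by simp [nyz, nyw]), eN_insert G col hG z _ (by simp [nzw]),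
    ← insert_empty_eq w, eN_insert G col hG w _ (by simp)] at h
  have f1 : 1 ≤ (({w} : Finset V).filter (fun u => col u ≠ col z)).card :=
    Finset.card_pos.2 ⟨w, by simp [hzw.symm]⟩
  have f2 : 1 ≤ (({z, w} : Finset V).filter (fun u => col u ≠ col y)).card := by
    apply Finset.card_pos.2
    by_cases h : col z = col y
    · exact ⟨w, by simp [← h, hzw.symm]⟩
    · exact ⟨z, by simp [h]⟩
  have f3 : 1 < (({y, z, w} : Finset V).filter (fun u => col u ≠ col x)).card := by
    apply Finset.one_lt_card.2
    by_cases h : col z = col x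
    · exact ⟨y, by simp [hxy.symm], w, by simp [← h, hzw.symm], nyw⟩
    · exact ⟨y, by simp [hxy.symm], z, by simp [h], nyz⟩
  rw [insert_empty_eq] at h
  omega

theorem MM_four' (hG : ∀ u v, G.Adj u v ↔ col u ≠ col v) (x y z w : V)
    (hxy : col x ≠ col y) (hxz : col x ≠ col z) (hyz : col y ≠ col z)
    (hxw : col x ≠ col w) (hyw : col y ≠ col w) (hzw : col z ≠ col w) : 6 ≤ MM G 4 := by
  classical
  have nxy : x ≠ y := fun h => hxy (by rw [h])
  have nxz : x ≠ z := fun h => hxz (by rw [h])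
  have nyz : y ≠ z := fun h => hyz (by rw [h])
  have nxw : x ≠ w := fun h => hxw (by rw [h])
  have nyw : y ≠ w := fun h => hyw (by rw [h])
  have nzw : z ≠ w := fun h => hzw (by rw [h])
  have h := eN_le_MM G {x, y, z, w}
  have hc : ({x, y, z, w} : Finset V).card = 4 := by
    simp [nxy, nxz, nyz, nxw, nyw, nzw]
  rw [hc, eN_insert G col hG x _ (by simp [nxy, nxz, nxw]),
    eN_insert G col hG y _ (by simp [nyz, nyw]), eN_insert G col hG z _ (by simp [nzw]),
    ← insert_empty_eq w, eN_insert G col hG w _ (by simp)] at h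
  simp [Finset.filter_insert, Finset.filter_singleton, hxy.symm, hxz.symm, hyz.symm, hxw.symm,
    hyw.symm, hzw.symm, nyz, nyw, nzw] at h
  omega

open Classical in
theorem MM_five (hG : ∀ u v, G.Adj u v ↔ col u ≠ col v) (i j l : Fin k) (hij : i ≠ j)
    (hil : i ≠ l) (hjl : j ≠ l)
    (hi : 2 ≤ (Finset.univ.filter (fun v => col v = i)).card)
    (hj : 2 ≤ (Finset.univ.filter (fun v => col v = j)).card)
    (hl : ∃ v, col v = l) : 8 ≤ MM G 5 := by
  obtain ⟨a, ha, b, hb, nab⟩ := Finset.one_lt_card.1 hi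
  obtain ⟨c, hc, d, hd, ncd⟩ := Finset.one_lt_card.1 hj
  obtain ⟨e, he⟩ := hl
  simp only [Finset.mem_filter, Finset.mem_univ, true_and] at ha hb hc hd
  have nac : a ≠ c := fun h => hij (by rw [← ha, ← hc, h])
  have nad : a ≠ d := fun h => hij (by rw [← ha, ← hd, h])
  have nbc : b ≠ c := fun h => hij (by rw [← hb, ← hc, h])
  have nbd : b ≠ d := fun h => hij (by rw [← hb, ← hd, h])
  have nae : a ≠ e := fun h => hil (by rw [← ha, ← he, h])
  have nbe : b ≠ e := fun h => hil (by rw [← hb, ← he, h])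
  have nce : c ≠ e := fun h => hjl (by rw [← hc, ← he, h])
  have nde : d ≠ e := fun h => hjl (by rw [← hd, ← he, h])
  have h := eN_le_MM G {a, b, c, d, e}
  have hcard : ({a, b, c, d, e} : Finset V).card = 5 := by
    simp [nab, nac, nad, nae, nbc, nbd, nbe, ncd, nce, nde]
  rw [hcard, eN_insert G col hG a _ (by simp [nab, nac, nad, nae]),
    eN_insert G col hG b _ (by simp [nbc, nbd, nbe]),
    eN_insert G col hG c _ (by simp [ncd, nce]), eN_insert G col hG d _ (by simp [nde]),
    ← insert_empty_eq e, eN_insert G col hG e _ (by simp)] at h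
  simp [Finset.filter_insert, Finset.filter_singleton, ha, hb, hc, hd, he, hij.symm, hil.symm,
    hjl.symm, ncd, nce, nde] at h
  omega

theorem eN_pos (hG : ∀ u v, G.Adj u v ↔ col u ≠ col v) (T : Finset V) (h : 0 < eN G T) :
    ∃ u ∈ T, ∃ v ∈ T, col u ≠ col v := by
  unfold eN at h
  rw [Set.ncard_pos] at h
  obtain ⟨e, he⟩ := h
  induction e using Sym2.ind with
  | _ x y =>
    exact ⟨x, he.2 x (by simp), y, he.2 y (by simp), (hG x y).1 he.1⟩

theorem three_hit {ι : Type*} (g : V → ι) (a b c : ι) (hab : a ≠ b) (hac : a ≠ c) (hbc : b ≠ c)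
    (P : V → Prop) [DecidablePred P] (ha : ∃ v, g v = a ∧ P v) (hb : ∃ v, g v = b ∧ P v) (hc : ∃ v, g v = c ∧ P v) :
    3 ≤ (Finset.univ.filter P).card := by
  obtain ⟨x, rfl, hx⟩ := ha
  obtain ⟨y, rfl, hy⟩ := hb
  obtain ⟨z, rfl, hz⟩ := hc
  have : 2 < (Finset.univ.filter P).card := Finset.two_lt_card.2
    ⟨x, by simp [hx], y, by simp [hy], z, by simp [hz], fun h => hab (by rw [h]),
      fun h => hac (by rw [h]), fun h => hbc (by rw [h])⟩
  omega

end small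

open Classical in
theorem upper {k : ℕ} (G : SimpleGraph V) (col : V → Fin k)
    (hG : ∀ u v, G.Adj u v ↔ col u ≠ col v) (hsurj : Function.Surjective col) (hk : 2 ≤ k)
    (n q : ℕ) (hn : Fintype.card V = n) (hq2 : 2 ≤ q) (hlow : n ≤ q + 3) (hhigh : q + 1 ≤ n)
    (hE1 : ¬ (q = 4 ∧ k = 2 ∧ ∀ i, 3 ≤ (Finset.univ.filter (fun v => col v = i)).card))
    (hE2 : ¬ (q = 6 ∧ k = 3 ∧ ∀ i, 3 ≤ (Finset.univ.filter (fun v => col v = i)).card))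
    {ι : Type*} [Fintype ι] (g : V → ι) (hg : Function.Surjective g)
    (hN : 2 ≤ Fintype.card ι)
    (hpair : ∀ i j, i ≠ j → (Finset.univ.filter (fun v => g v = i)).card +
      (Finset.univ.filter (fun v => g v = j)).card ≤ q) :
    ∑ i, eN G (Finset.univ.filter (fun v => g v = i)) ≤ MM G (q - 1) := by
  have conv : ∀ t, t + 2 ≤ n → 2 * MM G (t + 1) ≤ MM G (t + 2) + MM G t := by
    intro t ht; exact MM_conv G col hG t (by omega)
  have m0 : MM G 0 = 0 := by simpa using MM_le_choose G col hG 0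
  have m1 : MM G 1 = 0 := by simpa using MM_le_choose G col hG 1
  have m2 : MM G 2 ≤ 1 := by simpa using MM_le_choose G col hG 2
  have m3 : MM G 3 ≤ 3 := by simpa using MM_le_choose G col hG 3
  have mono : ∀ s t, s ≤ t → t ≤ n → MM G s ≤ MM G t := M_mono _ n conv m0
  have hle := fun i => eN_le_MM G (Finset.univ.filter (fun v => g v = i))
  have hex : ∀ i, 1 ≤ (Finset.univ.filter (fun v => g v = i)).card := by
    intro i
    obtain ⟨v, hv⟩ := hg i
    exact Finset.card_pos.2 ⟨v, by simp [hv]⟩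
  have hsum : ∑ i, (Finset.univ.filter (fun v => g v = i)).card = n := by
    rw [← hn, ← Finset.card_univ, Finset.card_eq_sum_card_fiberwise (f := g) (t := Finset.univ)]
    simp
  have hsub : ∀ s : Finset ι, ∑ i ∈ s, ((Finset.univ.filter (fun v => g v = i)).card - 1) + s.card =
      ∑ i ∈ s, (Finset.univ.filter (fun v => g v = i)).card := by
    intro s
    rw [Finset.card_eq_sum_ones, ← Finset.sum_add_distrib]
    exact Finset.sum_congr rfl fun i _ => Nat.sub_add_cancel (hex i)
  have hother : ∀ i : ι, ∃ j, i ≠ j := by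
    intro i
    have : Nontrivial ι := Fintype.one_lt_card_iff_nontrivial.1 hN
    obtain ⟨j, hj⟩ := exists_ne i
    exact ⟨j, hj.symm⟩
  have hsub' := hsub Finset.univ
  rw [hsum, Finset.card_univ] at hsub'
  have hsup := sum_super (MM G) n conv m1
    (fun i => (Finset.univ.filter (fun v => g v = i)).card) hex
  by_cases hA : n + 2 ≤ q + Fintype.card ι
  · calc _ ≤ ∑ i, MM G (Finset.univ.filter (fun v => g v = i)).card :=
          Finset.sum_le_sum fun i _ => hle i
      _ ≤ _ := hsup Finset.univ (by omega)
      _ ≤ _ := mono _ _ (by omega) (by omega)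
  by_cases hB : (Finset.univ.filter
      (fun i => 0 < eN G (Finset.univ.filter (fun v => g v = i)))).card ≤ 2
  · have hs : ∑ i, eN G (Finset.univ.filter (fun v => g v = i)) =
        ∑ i ∈ Finset.univ.filter (fun i => 0 < eN G (Finset.univ.filter (fun v => g v = i))),
          eN G (Finset.univ.filter (fun v => g v = i)) := by
      symm
      apply Finset.sum_subset (Finset.subset_univ _)
      intro i _ hi
      simp only [Finset.mem_filter, Finset.mem_univ, true_and] at hi
      omega
    rw [hs]
    generalize Finset.univ.filter
      (fun i => 0 < eN G (Finset.univ.filter (fun v => g v = i))) = s at hB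
    have h3 : s.card = 0 ∨ s.card = 1 ∨ s.card = 2 := by omega
    rcases h3 with h | h | h
    · rw [Finset.card_eq_zero.1 h]; simp
    · obtain ⟨i, rfl⟩ := Finset.card_eq_one.1 h
      rw [Finset.sum_singleton]
      obtain ⟨j, hj⟩ := hother i
      have := hpair i j hj
      have := hex j
      exact (hle i).trans (mono _ _ (by omega) (by omega))
    · obtain ⟨i, j, hij, rfl⟩ := Finset.card_eq_two.1 h
      rw [Finset.sum_pair hij]
      have h1 := hpair i j hij
      have h2 := transfer2 (MM G) n conv 1 _ _ _ (hex i) (hex j)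
        (Nat.sub_add_cancel (by have := hex i; omega)).symm (by omega)
      have h3 := mono ((Finset.univ.filter (fun v => g v = i)).card +
        (Finset.univ.filter (fun v => g v = j)).card - 1) (q - 1) (by omega) (by omega)
      have := hle i
      have := hle j
      omega
  push Not at hB
  obtain ⟨a, ha, b, hb, c, hc, hab, hac, hbc⟩ := Finset.two_lt_card.1 hB
  simp only [Finset.mem_filter, Finset.mem_univ, true_and] at ha hb hc
  have hle3 : ({a, b, c} : Finset ι).card = 3 := by simp [hab, hac, hbc]
  have hN3 : 3 ≤ Fintype.card ι := by
    rw [← hle3]; exact Finset.card_le_univ _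
  have spl : ∀ f : ι → ℕ, ∑ i, f i = f a + f b + f c + ∑ i ∈ ({a, b, c} : Finset ι)ᶜ, f i := by
    intro f
    rw [← Finset.sum_add_sum_compl ({a, b, c} : Finset ι) f, Finset.sum_insert (by simp [hab, hac]),
      Finset.sum_insert (by simp [hbc]), Finset.sum_singleton]
    ring
  have hrc : (({a, b, c} : Finset ι)ᶜ).card + 3 = Fintype.card ι := by
    rw [Finset.card_compl, hle3]; omega
  have hsubR := hsub ({a, b, c} : Finset ι)ᶜ
  have hsupR := hsup ({a, b, c} : Finset ι)ᶜ
  rw [spl] at hsum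
  rw [spl]
  have hR : ∑ i ∈ ({a, b, c} : Finset ι)ᶜ, eN G (Finset.univ.filter (fun v => g v = i)) ≤
      ∑ i ∈ ({a, b, c} : Finset ι)ᶜ, MM G (Finset.univ.filter (fun v => g v = i)).card :=
    Finset.sum_le_sum fun i _ => hle i
  have la := hle a
  have lb := hle b
  have lc := hle c
  have pab := hpair a b hab
  have pac := hpair a c hac
  have pbc := hpair b c hbc
  obtain ⟨ua, hua, va, hva, hea⟩ := eN_pos G col hG _ ha
  obtain ⟨ub, hub, vb, hvb, heb⟩ := eN_pos G col hG _ hb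
  obtain ⟨uc, huc, vc, hvc, hec⟩ := eN_pos G col hG _ hc
  have two : ∀ (i : ι) (u v : V), u ∈ Finset.univ.filter (fun v => g v = i) →
      v ∈ Finset.univ.filter (fun v => g v = i) → col u ≠ col v →
      2 ≤ (Finset.univ.filter (fun v => g v = i)).card := fun i u v hu hv h =>
    Finset.one_lt_card.2 ⟨u, hu, v, hv, fun h' => h (by rw [h'])⟩
  have ca := two a ua va hua hva hea
  have cb := two b ub vb hub hvb heb
  have cc := two c uc vc huc hvc hec
  simp only [Finset.mem_filter, Finset.mem_univ, true_and] at hua hva hub hvb huc hvc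
  have m4 : 4 ≤ MM G 4 := MM_four G col hG ua va ub vb hea heb
    (fun h => hab (by rw [← hua, ← hub, h])) (fun h => hab (by rw [← hua, ← hvb, h]))
    (fun h => hab (by rw [← hva, ← hub, h])) (fun h => hab (by rw [← hva, ← hvb, h]))
  have k3 : 3 ≤ k → 3 ≤ MM G 3 := by
    intro h
    obtain ⟨x, hx⟩ := hsurj ⟨0, by omega⟩
    obtain ⟨y, hy⟩ := hsurj ⟨1, by omega⟩
    obtain ⟨z, hz⟩ := hsurj ⟨2, by omega⟩
    exact MM_three G col hG x y z (by simp [hx, hy]) (by simp [hx, hz]) (by simp [hy, hz])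
  have incr : ∀ i l, i ≤ l → l + 1 ≤ n → MM G (i + 1) + MM G l ≤ MM G (l + 1) + MM G i := by
    intro i l hl h
    obtain ⟨d, rfl⟩ := Nat.exists_eq_add_of_le hl
    exact incr_mono (MM G) n conv i d (by omega)
  by_cases hX : Fintype.card ι + q = n + 1
  · -- case X
    have hq4 : 4 ≤ q := by omega
    have hd : MM G (q - 2) + 2 ≤ MM G (q - 1) := by
      obtain ⟨r, rfl⟩ := Nat.exists_eq_add_of_le hq4
      have e1 : 4 + r - 2 = r + 2 := by omega
      have e2 : 4 + r - 1 = r + 2 + 1 := by omega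
      rw [e1, e2]
      by_cases h3 : 3 ≤ MM G 3
      · have := incr 2 (r + 2) (by omega) (by omega)
        simp only [Nat.reduceAdd] at this
        omega
      · by_cases hr : r = 0
        · exfalso
          have hk2 : k = 2 := by
            by_contra hk3
            exact h3 (k3 (by omega))
          apply hE1
          refine ⟨by omega, hk2, fun i => ?_⟩
          have hit : ∀ u v : V, col u ≠ col v → col u = i ∨ col v = i := by
            intro u v h
            subst hk2
            omega
          refine three_hit g a b c hab hac hbc (fun v => col v = i) ?_ ?_ ?_
          · rcases hit _ _ hea with h | h
            exacts [⟨ua, hua, h⟩, ⟨va, hva, h⟩]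
          · rcases hit _ _ heb with h | h
            exacts [⟨ub, hub, h⟩, ⟨vb, hvb, h⟩]
          · rcases hit _ _ hec with h | h
            exacts [⟨uc, huc, h⟩, ⟨vc, hvc, h⟩]
        · have := incr 3 (r + 2) (by omega) (by omega)
          simp only [Nat.reduceAdd] at this
          omega
    have hs1 := hsupR (by omega)
    have t1 := transfer2 (MM G) n conv 1 _
      (1 + ∑ i ∈ ({a, b, c} : Finset ι)ᶜ, ((Finset.univ.filter (fun v => g v = i)).card - 1)) _
      (hex c) (by omega) (Nat.sub_add_cancel (by omega)).symm (by omega)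
    have t2 := transfer3 (MM G) n conv 2 _ _
      ((Finset.univ.filter (fun v => g v = c)).card + (1 + ∑ i ∈ ({a, b, c} : Finset ι)ᶜ,
        ((Finset.univ.filter (fun v => g v = i)).card - 1)) - 1) (q - 2) ca cb (by omega) (by omega) (by omega)
    omega
  · -- case Y
    have hc3 : Fintype.card ι = 3 := by omega
    have hnq : n = q + 3 := by omega
    have hR0 : ({a, b, c} : Finset ι)ᶜ = ∅ := by
      rw [← Finset.card_eq_zero]; omega
    rw [hR0] at hsum ⊢
    simp only [Finset.sum_empty, add_zero] at hsum ⊢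
    have t2 := transfer3 (MM G) n conv 3 (Finset.univ.filter (fun v => g v = a)).card
      (Finset.univ.filter (fun v => g v = b)).card
      (Finset.univ.filter (fun v => g v = c)).card (q - 3)
      (by omega) (by omega) (by omega) (by omega) (by omega)
    have step : ∀ i x, i + 3 ≤ q → MM G i + x ≤ MM G (i + 1) →
        MM G (q - 3) + 2 * x ≤ MM G (q - 1) := by
      intro i x hi hx
      have h1 := incr i (q - 3) (by omega) (by omega)
      have h2 := incr i (q - 3 + 1) (by omega) (by omega)
      have e : q - 1 = q - 3 + 1 + 1 := by omega
      rw [e]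
      omega
    by_cases h3 : 3 ≤ MM G 3
    · by_cases h4 : 6 ≤ MM G 4
      · have := step 3 3 (by omega) (by simp only [Nat.reduceAdd]; omega)
        omega
      · have hk3 : k = 3 := by
          apply le_antisymm
          · by_contra hk4
            apply h4
            obtain ⟨x, hx⟩ := hsurj ⟨0, by omega⟩
            obtain ⟨y, hy⟩ := hsurj ⟨1, by omega⟩
            obtain ⟨z, hz⟩ := hsurj ⟨2, by omega⟩
            obtain ⟨w, hw⟩ := hsurj ⟨3, by omega⟩
            exact MM_four' G col hG x y z w (by simp [hx, hy]) (by simp [hx, hz])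
              (by simp [hy, hz]) (by simp [hx, hw]) (by simp [hy, hw]) (by simp [hz, hw])
          · obtain ⟨T, hT, hTe⟩ := MM_attained G 3 (by omega)
            have hi := tri_inj G col hG T hT (by omega)
            have := Finset.card_image_of_injOn hi
            have h' := Finset.card_le_univ (T.image col)
            simp only [Fintype.card_fin] at h'
            omega
        subst hk3
        have hsing : ∀ i j : Fin 3, i ≠ j →
            ¬ ((Finset.univ.filter (fun v => col v = i)).card ≤ 1 ∧
              (Finset.univ.filter (fun v => col v = j)).card ≤ 1) := by
          rintro i j hij ⟨hi, hj⟩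
          have hit : ∀ u v : V, col u ≠ col v → (col u = i ∨ col u = j) ∨ (col v = i ∨ col v = j) := by
            intro u v h
            omega
          have h3 : 3 ≤ (Finset.univ.filter (fun v => col v = i ∨ col v = j)).card := by
            refine three_hit g a b c hab hac hbc (fun v => col v = i ∨ col v = j) ?_ ?_ ?_
            · rcases hit _ _ hea with h | h
              exacts [⟨ua, hua, h⟩, ⟨va, hva, h⟩]
            · rcases hit _ _ heb with h | h
              exacts [⟨ub, hub, h⟩, ⟨vb, hvb, h⟩]
            · rcases hit _ _ hec with h | h
              exacts [⟨uc, huc, h⟩, ⟨vc, hvc, h⟩]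
          rw [Finset.filter_or] at h3
          have := Finset.card_union_le (Finset.univ.filter (fun v => col v = i))
            (Finset.univ.filter (fun v => col v = j))
          omega
        have m5 : 8 ≤ MM G 5 := by
          have h01 := hsing 0 1 (by decide)
          have h02 := hsing 0 2 (by decide)
          have h12 := hsing 1 2 (by decide)
          by_cases c0 : (Finset.univ.filter (fun v => col v = 0)).card ≤ 1
          · exact MM_five G col hG 1 2 0 (by decide) (by decide) (by decide) (by omega) (by omega)
              (hsurj 0)
          · by_cases c1 : (Finset.univ.filter (fun v => col v = 1)).card ≤ 1
            · exact MM_five G col hG 0 2 1 (by decide) (by decide) (by decide) (by omega) (by omega)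
                (hsurj 1)
            · exact MM_five G col hG 0 1 2 (by decide) (by decide) (by decide) (by omega) (by omega)
                (hsurj 2)
        by_cases hq7 : 7 ≤ q
        · have := step 4 3 (by omega) (by simp only [Nat.reduceAdd]; omega)
          omega
        · have hq6 : q = 6 := by omega
          subst hq6
          have qa : (Finset.univ.filter (fun v => g v = a)).card = 3 := by omega
          have qb : (Finset.univ.filter (fun v => g v = b)).card = 3 := by omega
          have qc : (Finset.univ.filter (fun v => g v = c)).card = 3 := by omega
          by_cases hall : 3 ≤ eN G (Finset.univ.filter (fun v => g v = a)) ∧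
              3 ≤ eN G (Finset.univ.filter (fun v => g v = b)) ∧
              3 ≤ eN G (Finset.univ.filter (fun v => g v = c))
          · exfalso
            have hh : ∀ x : ι, (Finset.univ.filter (fun v => g v = x)).card = 3 →
                3 ≤ eN G (Finset.univ.filter (fun v => g v = x)) →
                ∀ i : Fin 3, ∃ v, g v = x ∧ col v = i := by
              intro x hx he i
              have hi := tri_inj G col hG _ hx he
              have hcard := Finset.card_image_of_injOn hi
              have hu : (Finset.univ.filter (fun v => g v = x)).image col = Finset.univ := by
                rw [← Finset.card_eq_iff_eq_univ, hcard, hx]; simp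
              have := Finset.mem_univ i
              rw [← hu, Finset.mem_image] at this
              obtain ⟨v, hv, hvi⟩ := this
              exact ⟨v, by simpa using hv, hvi⟩
            exact hE2 ⟨rfl, rfl, fun i => three_hit g a b c hab hac hbc (fun v => col v = i)
              (hh a qa hall.1 i) (hh b qb hall.2.1 i) (hh c qc hall.2.2 i)⟩
          · rw [qa] at la
            rw [qb] at lb
            rw [qc] at lc
            simp only [Nat.reduceSub]
            omega
    · have := step 3 2 (by omega) (by simp only [Nat.reduceAdd]; omega)
      omega

theorem eN_compl (G : SimpleGraph V) (S T : Finset V) (hST : ∀ v, v ∈ T ↔ v ∉ S) :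
    G.edgeSet.ncard = (incE G S).ncard + eN G T := by
  unfold eN
  rw [← Set.ncard_union_eq _ (Set.toFinite _) (Set.toFinite _)]
  · congr 1
    ext e
    simp only [incE, inE, Set.mem_union, Set.mem_ofPred_eq, hST]
    constructor
    · intro h
      by_cases h' : ∃ v ∈ S, v ∈ e
      · exact Or.inl ⟨h, h'⟩
      · push Not at h'
        exact Or.inr ⟨h, fun v hv hS => h' v hS hv⟩
    · rintro (h | h) <;> exact h.1
  · rw [Set.disjoint_left]
    rintro e ⟨_, v, hv, hve⟩ ⟨_, h⟩
    exact (hST v).1 (h v hve) hv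

theorem lower_inS (G : SimpleGraph V) (n q : ℕ) (hn : Fintype.card V = n) (hq2 : 2 ≤ q)
    (hhigh : q + 1 ≤ n) (S : Finset V) (hS : S.card = n - q + 1) :
    ∃ H : SimpleGraph V, inS G H q ∧ H.edgeSet.ncard = G.edgeSet.ncard - (incE G S).ncard := by
  classical
  let H : SimpleGraph V :=
    { Adj := fun u v => G.Adj u v ∧ u ∉ S ∧ v ∉ S
      symm := ⟨fun u v h => ⟨h.1.symm, h.2.2, h.2.1⟩⟩
      loopless := ⟨fun u h => G.loopless.irrefl u h.1⟩ }
  have hadj : ∀ u v, H.Adj u v ↔ G.Adj u v ∧ u ∉ S ∧ v ∉ S := fun u v => Iff.rfl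
  -- vertices of S are isolated
  have iso : ∀ s ∈ S, ∀ v, H.Reachable s v → v = s := by
    intro s hs v hr
    obtain ⟨w⟩ := hr
    cases w with
    | nil => rfl
    | cons h _ => exact absurd hs ((hadj _ _).1 h).2.1
  have single : ∀ s ∈ S, (H.connectedComponentMk s).supp = {s} := by
    intro s hs
    ext v
    simp only [ConnectedComponent.mem_supp_iff, ConnectedComponent.eq, Set.mem_singleton_iff]
    constructor
    · intro h; exact iso s hs v h.symm
    · rintro rfl; exact Reachable.refl _
  have hcases : ∀ C : H.ConnectedComponent, C.supp.ncard = 1 ∨ C.supp ⊆ ((Sᶜ : Finset V) : Set V) := by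
    intro C
    by_cases h : ∃ s ∈ S, s ∈ C.supp
    · left
      obtain ⟨s, hs, hsC⟩ := h
      rw [ConnectedComponent.mem_supp_iff] at hsC
      rw [← hsC, single s hs, Set.ncard_singleton]
    · right
      intro v hv
      simp only [Finset.coe_compl, Set.mem_compl_iff, Finset.mem_coe]
      exact fun hvS => h ⟨v, hvS, hv⟩
  have hSc : ((Sᶜ : Finset V) : Set V).ncard = q - 1 := by
    rw [Set.ncard_coe_finset, Finset.card_compl]; omega
  refine ⟨H, ⟨fun u v h => h.1, ?_, ?_⟩, ?_⟩
  · intro hc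
    obtain ⟨s, hs, t, ht, hst⟩ := Finset.one_lt_card.1 (show 1 < S.card by omega)
    exact hst (iso s hs t (hc.preconnected s t)).symm
  · intro C D hCD
    have sub : ∀ C : H.ConnectedComponent, C.supp ⊆ ((Sᶜ : Finset V) : Set V) →
        C.supp.ncard ≤ q - 1 := fun C h => hSc ▸ Set.ncard_le_ncard h (Set.toFinite _)
    rcases hcases C with h1 | h1 <;> rcases hcases D with h2 | h2
    · omega
    · have := sub D h2; omega
    · have := sub C h1; omega
    · rw [← Set.ncard_union_eq (pairwise_disjoint_supp_connectedComponent H hCD)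
        (Set.toFinite _) (Set.toFinite _)]
      have := Set.ncard_le_ncard (Set.union_subset h1 h2) (Set.toFinite _)
      omega
  · rw [eN_compl G S Sᶜ (by simp), Nat.add_sub_cancel_left]
    unfold eN
    congr 1
    ext e
    induction e using Sym2.ind with
    | _ x y => simp [inE, H]

theorem upper_H {k : ℕ} (G : SimpleGraph V) (col : V → Fin k)
    (hG : ∀ u v, G.Adj u v ↔ col u ≠ col v) (hsurj : Function.Surjective col) (hk : 2 ≤ k)
    (n q : ℕ) (hn : Fintype.card V = n) (hq2 : 2 ≤ q) (hlow : n ≤ q + 3) (hhigh : q + 1 ≤ n)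
    (hE1 : ¬ (q = 4 ∧ k = 2 ∧ ∀ i, 3 ≤ (Finset.univ.filter (fun v => col v = i)).card))
    (hE2 : ¬ (q = 6 ∧ k = 3 ∧ ∀ i, 3 ≤ (Finset.univ.filter (fun v => col v = i)).card))
    (H : SimpleGraph V) (hH : inS G H q) : H.edgeSet.ncard ≤ MM G (q - 1) := by
  classical
  obtain ⟨hle, hnc, hpair⟩ := hH
  have hfin : Finite H.ConnectedComponent := Quot.finite _
  have : Fintype H.ConnectedComponent := Fintype.ofFinite _
  have hne : Nonempty V := Fintype.card_pos_iff.1 (by omega)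
  have hsupp : ∀ C : H.ConnectedComponent, C.supp.ncard =
      (Finset.univ.filter (fun v => H.connectedComponentMk v = C)).card := by
    intro C
    rw [← Set.ncard_coe_finset]
    congr 1
    ext v
    simp [ConnectedComponent.mem_supp_iff]
  have hN : 2 ≤ Fintype.card H.ConnectedComponent := by
    by_contra h
    apply hnc
    have hsub : Subsingleton H.ConnectedComponent :=
      Fintype.card_le_one_iff_subsingleton.1 (by omega)
    exact { preconnected := fun u v => ConnectedComponent.exact (Subsingleton.elim _ _)
            nonempty := hne }
  have main := upper G col hG hsurj hk n q hn hq2 hlow hhigh hE1 hE2 H.connectedComponentMk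
    Quot.mk_surjective hN (by
      intro i j hij
      have := hpair i j hij
      rw [hsupp, hsupp] at this
      convert this)
  refine le_trans ?_ main
  have hsubset : H.edgeSet ⊆ ⋃ C : H.ConnectedComponent,
      inE G (Finset.univ.filter (fun v => H.connectedComponentMk v = C)) := by
    intro e he
    induction e using Sym2.ind with
    | _ x y =>
      rw [SimpleGraph.mem_edgeSet] at he
      simp only [Set.mem_iUnion]
      refine ⟨H.connectedComponentMk x, (hle he : G.Adj x y), ?_⟩
      intro v hv
      rw [Sym2.mem_iff] at hv
      simp only [Finset.mem_filter, Finset.mem_univ, true_and]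
      rcases hv with rfl | rfl
      · rfl
      · exact ConnectedComponent.sound he.symm.reachable
  calc H.edgeSet.ncard ≤ _ := Set.ncard_le_ncard hsubset (Set.toFinite _)
    _ ≤ _ := Set.ncard_iUnion_le_of_fintype _
    _ = _ := by unfold eN; congr! 
/-- Let `G = K_{p₁,…,p_k}` with `k ≥ 2`, `n = p₁ + ⋯ + p_k`, `n−3 ≤ q ≤ n−1` and `q ≥ 2`.
If `(G, q)` is none of `(K_{3,3},4)`, `(K_{4,3},4)`, `(K_{3,3,3},6)`, then
`ℓ_q(G) = |E(G)| − min_{|S| = n−q+1} |E_G(S)|`. -/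
theorem stmt13 (k : ℕ) (hk : 2 ≤ k) (p : Fin k → ℕ) (hp : ∀ i, 1 ≤ p i)
    (n : ℕ) (hn : n = ∑ i, p i) (q : ℕ) (hq2 : 2 ≤ q)
    (hqlow : n - 3 ≤ q) (hqhigh : q ≤ n - 1)
    (hexc : ¬ ((q = 4 ∧ ((Finset.univ.val.map p : Multiset ℕ) = {3, 3} ∨
                        (Finset.univ.val.map p : Multiset ℕ) = {4, 3})) ∨
               (q = 6 ∧ (Finset.univ.val.map p : Multiset ℕ) = {3, 3, 3}))) :
    ell (completeMultipartiteGraph fun i : Fin k => Fin (p i)) q =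
      (completeMultipartiteGraph fun i : Fin k => Fin (p i)).edgeSet.ncard -
        sInf {m | ∃ S : Finset (Σ i : Fin k, Fin (p i)), S.card = n - q + 1 ∧
          (incE (completeMultipartiteGraph fun i : Fin k => Fin (p i)) S).ncard = m} := by
  have hG : ∀ u v, (completeMultipartiteGraph fun i : Fin k => Fin (p i)).Adj u v ↔
      Sigma.fst u ≠ Sigma.fst v := fun u v => Iff.rfl
  have hcard : Fintype.card (Σ i : Fin k, Fin (p i)) = n := by
    rw [hn]; simp
  have hclass : ∀ i, (Finset.univ.filter
      (fun v : (Σ i : Fin k, Fin (p i)) => v.1 = i)).card = p i := by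
    intro i
    have : Finset.univ.filter (fun v : (Σ i : Fin k, Fin (p i)) => v.1 = i) =
        Finset.univ.map ⟨fun x : Fin (p i) => (⟨i, x⟩ : Σ i : Fin k, Fin (p i)),
          fun x y h => by simpa using h⟩ := by
      ext ⟨j, x⟩
      simp only [Finset.mem_filter, Finset.mem_univ, true_and, Finset.mem_map,
        Function.Embedding.coeFn_mk]
      constructor
      · rintro rfl; exact ⟨x, rfl⟩
      · rintro ⟨y, hy⟩; exact (congrArg Sigma.fst hy).symm
    rw [this, Finset.card_map]; simp
  have hpos : 2 ≤ n := by
    have h1 : ∑ i : Fin k, 1 ≤ ∑ i, p i := Finset.sum_le_sum fun i _ => hp i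
    simp at h1
    omega
  have hsurj : Function.Surjective (Sigma.fst : (Σ i : Fin k, Fin (p i)) → Fin k) :=
    fun i => ⟨⟨i, ⟨0, hp i⟩⟩, rfl⟩
  have hE1 : ¬ (q = 4 ∧ k = 2 ∧ ∀ i, 3 ≤ (Finset.univ.filter
      (fun v : (Σ i : Fin k, Fin (p i)) => v.1 = i)).card) := by
    rintro ⟨h4, hk2, hall⟩
    simp only [hclass] at hall
    apply hexc
    left
    refine ⟨h4, ?_⟩
    subst hk2
    rw [Fin.sum_univ_two] at hn
    have h0 := hall 0
    have h1 := hall 1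
    have hm : (Finset.univ.val.map p : Multiset ℕ) = {p 0, p 1} := rfl
    rw [hm]
    have h3 : (p 0 = 3 ∧ p 1 = 3) ∨ (p 0 = 4 ∧ p 1 = 3) ∨ (p 0 = 3 ∧ p 1 = 4) := by omega
    rcases h3 with ⟨a, b⟩ | ⟨a, b⟩ | ⟨a, b⟩
    · left; rw [a, b]
    · right; rw [a, b]
    · right; rw [a, b]; exact Multiset.pair_comm 3 4
  have hE2 : ¬ (q = 6 ∧ k = 3 ∧ ∀ i, 3 ≤ (Finset.univ.filter
      (fun v : (Σ i : Fin k, Fin (p i)) => v.1 = i)).card) := by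
    rintro ⟨h4, hk2, hall⟩
    simp only [hclass] at hall
    apply hexc
    right
    refine ⟨h4, ?_⟩
    subst hk2
    rw [Fin.sum_univ_three] at hn
    have h0 := hall 0
    have h1 := hall 1
    have h2 := hall 2
    have hm : (Finset.univ.val.map p : Multiset ℕ) = {p 0, p 1, p 2} := rfl
    rw [hm, show p 0 = 3 by omega, show p 1 = 3 by omega, show p 2 = 3 by omega]
  clear hexc
  generalize hGG : (completeMultipartiteGraph fun i : Fin k => Fin (p i)) = G at hG ⊢
  have hup := upper_H G Sigma.fst hG hsurj hk n q hcard hq2 (by omega) (by omega) hE1 hE2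
  obtain ⟨T, hT, hTe⟩ := MM_attained G (q - 1) (by omega)
  have hTmem : (incE G Tᶜ).ncard ∈ {m | ∃ S : Finset (Σ i : Fin k, Fin (p i)),
      S.card = n - q + 1 ∧ (incE G S).ncard = m} := by
    refine ⟨Tᶜ, ?_, rfl⟩
    rw [Finset.card_compl, hcard]; omega
  have hTsplit := eN_compl G Tᶜ T (by simp)
  have hinf := Nat.sInf_le hTmem
  have hub : ∀ m ∈ {m | ∃ H : SimpleGraph (Σ i : Fin k, Fin (p i)),
      inS G H q ∧ H.edgeSet.ncard = m}, m ≤ MM G (q - 1) := by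
    rintro m ⟨H, hH, rfl⟩
    exact hup H hH
  obtain ⟨S, hS, hSe⟩ := Nat.sInf_mem (⟨_, hTmem⟩ : Set.Nonempty _)
  obtain ⟨H, hH, hHe⟩ := lower_inS G n q hcard hq2 (by omega) S hS
  rw [hSe] at hHe
  unfold ell
  apply le_antisymm
  · have hne : Set.Nonempty {m | ∃ H : SimpleGraph (Σ i : Fin k, Fin (p i)),
        inS G H q ∧ H.edgeSet.ncard = m} := ⟨_, H, hH, rfl⟩
    refine (csSup_le hne hub).trans ?_
    omega
  · exact le_csSup ⟨MM G (q - 1), fun m hm => hub m hm⟩ ⟨H, hH, hHe⟩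
end

section
/- Let G be a complete k-partite graph with partite sets X₁,…,X_k (k ≥ 2), and let T₀ be a b-element subset of V(G). Then |E(G[T₀])| ≥ |E(G[T])| for every b-element subset T of V(G) if and only if for every pair of distinct indices i, j, if |X_i ∩ T₀| ≥ |X_j ∩ T₀| + 2 then X_j ⊆ T₀. -/
open SimpleGraph

lemma edge_count (k : ℕ) (p : Fin k → ℕ) (T : Finset (Σ i : Fin k, Fin (p i))) :
    2 * ((completeMultipartiteGraph fun i : Fin k => Fin (p i)).induce
            (T : Set (Σ i : Fin k, Fin (p i)))).edgeSet.ncard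
      + ∑ i : Fin k, (T.filter fun v => v.1 = i).card ^ 2 = T.card ^ 2 := by
  classical
  set H := (completeMultipartiteGraph fun i : Fin k => Fin (p i)).induce
            (T : Set (Σ i : Fin k, Fin (p i))) with hH
  have h1 : H.edgeSet.ncard = H.edgeFinset.card := by
    rw [← SimpleGraph.coe_edgeFinset, Set.ncard_coe_finset]
  rw [h1, ← SimpleGraph.sum_degrees_eq_twice_card_edges]
  have h2 : ∀ v : (T : Set (Σ i : Fin k, Fin (p i))),
      H.degree v = (T.filter fun w => ¬ w.1 = v.1.1).card := by
    intro v
    rw [← SimpleGraph.card_neighborFinset_eq_degree]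
    refine Finset.card_bij (fun w _ => w.1) ?_ ?_ ?_
    · intro w hw
      have hw' : H.Adj v w := by simpa using hw
      have : v.1.1 ≠ w.1.1 := by simpa [hH] using hw'
      exact Finset.mem_filter.2 ⟨w.2, this.symm⟩
    · intro a _ b _ h
      exact Subtype.ext h
    · intro w hw
      obtain ⟨hw1, hw2⟩ := Finset.mem_filter.1 hw
      refine ⟨⟨w, hw1⟩, ?_, rfl⟩
      have : H.Adj v ⟨w, hw1⟩ := by
        simpa [hH] using fun h => hw2 (Eq.symm h)
      simpa using this
  have h3 : ∑ v, H.degree v = ∑ v ∈ T, (T.filter fun w => ¬ w.1 = v.1).card := by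
    rw [Finset.sum_congr rfl (fun v _ => h2 v)]
    exact Finset.sum_coe_sort T (fun v => (T.filter fun w => ¬ w.1 = v.1).card)
  have h4 : ∑ i : Fin k, (T.filter fun v => v.1 = i).card ^ 2
      = ∑ v ∈ T, (T.filter fun w => w.1 = v.1).card := by
    rw [← Finset.sum_fiberwise T (fun v => v.1)]
    refine Finset.sum_congr rfl fun i _ => ?_
    rw [Finset.sum_congr rfl (g := fun _ => (T.filter fun w => w.1 = i).card)]
    · simp [sq]
    · intro v hv
      rw [(Finset.mem_filter.1 hv).2]
  rw [h3, h4, ← Finset.sum_add_distrib]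
  rw [Finset.sum_congr rfl (g := fun _ => T.card)]
  · simp [sq]
  · intro v _
    rw [add_comm]
    exact Finset.card_filter_add_card_filter_not _

lemma part_sum (k : ℕ) (p : Fin k → ℕ) (T : Finset (Σ i : Fin k, Fin (p i))) :
    ∑ i : Fin k, (T.filter fun v => v.1 = i).card = T.card := by
  rw [Finset.card_eq_sum_card_fiberwise (f := fun v => v.1) (t := Finset.univ)]
  intro v _
  simp

lemma convex_step (k : ℕ) (t s : Fin k → ℤ) (hs : ∑ i, s i = ∑ i, t i)
    (h : ∀ i j, t j < s j → t i ≤ t j + 1) : ∑ i, t i ^ 2 ≤ ∑ i, s i ^ 2 := by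
  classical
  by_cases hne : (Finset.univ.filter fun j => t j < s j).Nonempty
  · obtain ⟨m, hm, hmin⟩ := Finset.exists_min_image _ t hne
    have hm' := (Finset.mem_filter.1 hm).2
    have key : ∀ i ∈ Finset.univ, t i ^ 2 + (2 * t m + 1) * (s i - t i) ≤ s i ^ 2 := by
      intro i _
      have h1 := h i m hm'
      rcases lt_trichotomy (t i) (s i) with hlt | heq | hgt
      · have h2 := hmin i (Finset.mem_filter.2 ⟨Finset.mem_univ _, hlt⟩)
        nlinarith [mul_nonneg (sub_nonneg.2 hlt.le) (show 0 ≤ s i + t i - 2 * t m - 1 by omega)]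
      · rw [heq]; simp
      · nlinarith [mul_nonneg (sub_nonneg.2 hgt.le) (show 0 ≤ -(s i + t i - 2 * t m - 1) by omega)]
    have := Finset.sum_le_sum key
    rw [Finset.sum_add_distrib, ← Finset.mul_sum, Finset.sum_sub_distrib, hs] at this
    simpa using this
  · have hle : ∀ i ∈ Finset.univ, s i ≤ t i := by
      intro i _
      by_contra hc
      exact hne ⟨i, Finset.mem_filter.2 ⟨Finset.mem_univ _, not_le.1 hc⟩⟩
    have := (Finset.sum_eq_sum_iff_of_le hle).1 hs
    exact le_of_eq (Finset.sum_congr rfl fun i hi => by rw [this i hi])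

lemma swap_sum (k : ℕ) (t s : Fin k → ℤ) (i j : Fin k) (hij : i ≠ j)
    (h : ∀ l, s l = t l - (if l = i then 1 else 0) + (if l = j then 1 else 0)) :
    ∑ l, s l ^ 2 = ∑ l, t l ^ 2 - 2 * t i + 2 * t j + 2 := by
  have : ∀ l, s l ^ 2 = t l ^ 2 + (if l = i then (1 - 2 * t l) else 0)
      + (if l = j then (1 + 2 * t l) else 0) := by
    intro l
    rw [h l]
    by_cases h1 : l = i
    · have h2 : l ≠ j := fun h => hij (h1.symm.trans h)
      simp only [h1, if_true, if_neg hij]; ring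
    · by_cases h2 : l = j
      · simp only [h2, if_true, if_neg hij.symm]; ring
      · simp [h1, h2]
  simp_rw [this]
  rw [Finset.sum_add_distrib, Finset.sum_add_distrib]
  simp
  ring



/-- Let `G` be the complete `k`-partite graph with partite sets `X_i = {i} × Fin (p i)`
(`k ≥ 2`) and let `T₀` be a `b`-element vertex subset.  Then `T₀` maximizes the number of
edges of the induced subgraph among `b`-element subsets if and only if for all distinct
`i, j`: `|X_i ∩ T₀| ≥ |X_j ∩ T₀| + 2` implies `X_j ⊆ T₀`. -/
theorem stmt14 (k : ℕ) (hk : 2 ≤ k) (p : Fin k → ℕ) (b : ℕ)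
    (T₀ : Finset (Σ i : Fin k, Fin (p i))) (hb : T₀.card = b) :
    (∀ T : Finset (Σ i : Fin k, Fin (p i)), T.card = b →
        ((completeMultipartiteGraph fun i : Fin k => Fin (p i)).induce
            (T : Set (Σ i : Fin k, Fin (p i)))).edgeSet.ncard ≤
          ((completeMultipartiteGraph fun i : Fin k => Fin (p i)).induce
            (T₀ : Set (Σ i : Fin k, Fin (p i)))).edgeSet.ncard) ↔
    (∀ i j : Fin k, i ≠ j →
        (T₀.filter fun v => v.1 = j).card + 2 ≤ (T₀.filter fun v => v.1 = i).card →
        ∀ x : Fin (p j), (⟨j, x⟩ : Σ i : Fin k, Fin (p i)) ∈ T₀) := by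
  classical
  subst hb
  constructor
  · intro H i j hij hc x
    by_contra hx
    have hpos : 0 < (T₀.filter fun v => v.1 = i).card := by omega
    obtain ⟨y, hy⟩ := Finset.card_pos.1 hpos
    obtain ⟨hyT, hyi⟩ := Finset.mem_filter.1 hy
    have hx' : (⟨j, x⟩ : Σ i : Fin k, Fin (p i)) ∉ T₀.erase y :=
      fun h => hx (Finset.mem_of_mem_erase h)
    have hcard : (insert (⟨j, x⟩ : Σ i : Fin k, Fin (p i)) (T₀.erase y)).card = T₀.card := by
      rw [Finset.card_insert_of_notMem hx', Finset.card_erase_add_one hyT]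
    have hle := H _ hcard
    have e1 := edge_count k p T₀
    have e2 := edge_count k p (insert (⟨j, x⟩ : Σ i : Fin k, Fin (p i)) (T₀.erase y))
    rw [hcard] at e2
    have e3 := swap_sum k (fun l => ((T₀.filter fun v => v.1 = l).card : ℤ))
      (fun l => (((insert (⟨j, x⟩ : Σ i : Fin k, Fin (p i)) (T₀.erase y)).filter
        fun v => v.1 = l).card : ℤ)) i j hij (by
        intro l
        have a1 : (((T₀.erase y).filter fun v => v.1 = l).card : ℤ)
            = (T₀.filter fun v => v.1 = l).card - (if l = i then 1 else 0) := by
          rw [Finset.filter_erase]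
          by_cases hl : l = i
          · have hm : y ∈ T₀.filter fun v => v.1 = l :=
              Finset.mem_filter.2 ⟨hyT, hyi.trans hl.symm⟩
            have := Finset.card_erase_add_one hm
            rw [if_pos hl]
            omega
          · rw [Finset.erase_eq_of_notMem, if_neg hl]
            · simp
            · intro hm
              exact hl ((Finset.mem_filter.1 hm).2.symm.trans hyi)
        rw [← a1, Finset.filter_insert]
        by_cases hl : l = j
        · rw [if_pos hl.symm, if_pos hl, Finset.card_insert_of_notMem]
          · push_cast; rfl
          · intro hm
            exact hx' (Finset.mem_filter.1 hm).1
        · rw [if_neg (fun h => hl (Eq.symm h)), if_neg hl]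
          simp)
    zify at e1 e2 hle hc
    linarith
  · intro H T hT
    have e1 := edge_count k p T₀
    have e2 := edge_count k p T
    rw [hT] at e2
    have e3 := convex_step k (fun l => ((T₀.filter fun v => v.1 = l).card : ℤ))
      (fun l => ((T.filter fun v => v.1 = l).card : ℤ))
      (by have a := part_sum k p T₀
          have b := part_sum k p T
          rw [hT, ← a] at b
          exact_mod_cast b)
      (by
        intro i j hlt
        by_contra hc
        have hij : i ≠ j := by
          rintro rfl
          omega
        have hall := H i j hij (by omega)
        have hsub : (T.filter fun v => v.1 = j) ⊆ (T₀.filter fun v => v.1 = j) := by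
          rintro ⟨l, x⟩ hv
          have hl : l = j := (Finset.mem_filter.1 hv).2
          subst hl
          exact Finset.mem_filter.2 ⟨hall x, rfl⟩
        have := Finset.card_le_card hsub
        omega)
    zify at e1 e2 ⊢
    linarith
end

section
/- Let G = K_{p₁,…,p_k} with k ≥ 2, p₁ ≥ ⋯ ≥ p_k ≥ 1 and n = p₁ + ⋯ + p_k. If (4n−2)/5 ≤ q ≤ n−1 and p₁ − p₂ ≥ (n+2)/5, then ar(G, T_q) = |E(G)| + 1 − (n−q+1)(n−p₁). -/
open SimpleGraph

variable {V : Type} [Fintype V]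

/-- harmonic concavity bound -/
lemma num_harm {ι : Type*} (K : Finset ι) (a P : ι → ℤ) (j s h : ℤ) (hs : 0 < s)
    (ha : ∀ k ∈ K, 0 ≤ a k) (haP : ∀ k ∈ K, a k ≤ P k) (hP : ∀ k ∈ K, P k ≤ h)
    (hj : ∑ k ∈ K, a k = j) (hsum : ∑ k ∈ K, P k = s) :
    s * ∑ k ∈ K, a k * (P k - a k) ≤ h * (j * (s - j)) := by
  have key : ∀ k ∈ K, s ^ 2 * (a k * (P k - a k)) ≤
      h * (a k * (s - j) ^ 2 + (P k - a k) * j ^ 2) := by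
    intro k hk
    have h1 : s ^ 2 * (a k * (P k - a k)) ≤
      P k * (a k * (s - j) ^ 2 + (P k - a k) * j ^ 2) := by
      nlinarith [sq_nonneg (a k * (s - j) - (P k - a k) * j)]
    refine h1.trans ?_
    have h2 : 0 ≤ a k * (s - j) ^ 2 + (P k - a k) * j ^ 2 :=
      add_nonneg (mul_nonneg (ha k hk) (sq_nonneg _))
        (mul_nonneg (by linarith [haP k hk]) (sq_nonneg _))
    exact mul_le_mul_of_nonneg_right (hP k hk) h2
  have h3 := Finset.sum_le_sum key
  rw [← Finset.mul_sum, ← Finset.mul_sum, Finset.sum_add_distrib, ← Finset.sum_mul,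
    ← Finset.sum_mul, Finset.sum_sub_distrib, hj, hsum] at h3
  have h4 : s * (s * ∑ k ∈ K, a k * (P k - a k)) ≤ s * (h * (j * (s - j))) := by
    nlinarith [h3]
  exact le_of_mul_le_mul_left h4 hs

lemma num_F1 {ι : Type*} (K : Finset ι) (a P : ι → ℤ) (i j p s h : ℤ) (hs : 0 < s) (hh : 0 ≤ h)
    (ha : ∀ k ∈ K, 0 ≤ a k) (haP : ∀ k ∈ K, a k ≤ P k) (hP : ∀ k ∈ K, P k ≤ h)
    (hj : ∑ k ∈ K, a k = j) (hsum : ∑ k ∈ K, P k = s) (cut : ℤ)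
    (hcut : cut = (i + j) * ((p + s) - (i + j)) - i * (p - i) - ∑ k ∈ K, a k * (P k - a k)) :
    s * (4 * (i + j) * ((p + s) - (i + j)) - (p - h) ^ 2) ≤ 4 * (s + h) * cut := by
  have h1 := num_harm K a P j s h hs ha haP hP hj hsum
  set Q := ∑ k ∈ K, a k * (P k - a k)
  have h2 : s * cut ≥ s * ((i + j) * ((p + s) - (i + j)) - i * (p - i)) - h * (j * (s - j)) := by
    rw [hcut]; linarith
  have h3 : s * (s * (4 * (i + j) * ((p + s) - (i + j)) - (p - h) ^ 2)) ≤
      s * (4 * (s + h) * cut) := by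
    have h4 := mul_le_mul_of_nonneg_left h2 (show 0 ≤ 4 * (s + h) by linarith)
    nlinarith [sq_nonneg (2 * (s + h) * j - s * (2 * (i + j) - (p - h)))]
  exact le_of_mul_le_mul_left h3 hs

lemma num_F2 {ι : Type*} (K : Finset ι) (a P : ι → ℤ) (i j p s h : ℤ)
    (ha : ∀ k ∈ K, 0 ≤ a k) (hP : ∀ k ∈ K, P k ≤ h)
    (hj : ∑ k ∈ K, a k = j) (cut : ℤ)
    (hcut : cut = (i + j) * ((p + s) - (i + j)) - i * (p - i) - ∑ k ∈ K, a k * (P k - a k)) :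
    (i + j) * s + j * (p - h) - j * (2 * (i + j) - j - 1) ≤ cut := by
  have : ∑ k ∈ K, a k * (P k - a k) ≤ ∑ k ∈ K, a k * (h - 1) := by
    apply Finset.sum_le_sum
    intro k hk
    have h1 := ha k hk
    have h2 := hP k hk
    rcases eq_or_lt_of_le h1 with h3 | h3
    · rw [← h3]; simp
    · apply mul_le_mul_of_nonneg_left _ h1
      linarith [Int.add_one_le_of_lt h3]
  rw [← Finset.sum_mul, hj] at this
  rw [hcut]
  nlinarith

lemma ar_case1 (n p s h g d r j T : ℤ) (hn : n = p + s) (hg : g = p - h) (hhs : h ≤ s) (hs : 0 ≤ s)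
    (hj0 : 0 ≤ j) (hgd : d + 1 ≤ g) (hr : d + 2 ≤ r)
    (hc : 4 * r ≤ n + g + 2 * d + 4)
    (hT : (r * s + j * g - j * (2 * r - j - 1)) + (r * s + j * g - 2 * j * (r - d - 2)) ≤ T) :
    2 * (d + 2) * s ≤ T := by
  refine le_trans ?_ hT
  obtain ⟨y, rfl⟩ : ∃ y, r = y + d + 2 := ⟨r - d - 2, by ring⟩
  obtain ⟨G, rfl⟩ : ∃ G, g = G + d + 1 := ⟨g - d - 1, by ring⟩
  have hy : 0 ≤ y := by linarith
  have hG : 0 ≤ G := by linarith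
  have hsG : 2 * y + 1 ≤ s + G := by linarith
  have key : 0 ≤ 2 * y * s + 2 * j * G - 4 * y * j + j * (j - 1) := by
    have hjj : 0 ≤ j * (j - 1) := by
      rcases eq_or_lt_of_le hj0 with h3 | h3
      · rw [← h3]; simp
      · exact mul_nonneg hj0 (by linarith [Int.add_one_le_of_lt h3])
    by_cases hz : 2 * y ≤ G
    · nlinarith [mul_nonneg hj0 (show 0 ≤ G - 2 * y by linarith), mul_nonneg hy hs]
    · push Not at hz
      have h1 : 0 ≤ (j - (2 * y - G)) * (j - (2 * y - G) - 1) := by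
        rcases le_or_gt (j - (2 * y - G)) 0 with h | h
        · exact mul_nonneg_of_nonpos_of_nonpos h (by linarith)
        · exact mul_nonneg h.le (by linarith [Int.add_one_le_of_lt h])
      have h2 : 0 ≤ 2 * y * (s + G - 2 * y - 1) := mul_nonneg (by linarith) (by linarith)
      have h3 : 0 ≤ (2 * y - G + 1) * G := mul_nonneg (by linarith) hG
      nlinarith
  nlinarith

lemma ar_case3 (n g e x : ℤ) (he : 2 ≤ e) (he5 : 5 * e ≤ n + 7) (hg5 : n + 2 ≤ 5 * g)
    (hgn : g + 2 ≤ n) (hx : 2 * x ≤ n) (hN : n + g + 2 * e < 4 * (n - x)) (hgx : g < 2 * x) :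
    8 * (n - g) * e * x ≤ n * (4 * x * (n - x) - g ^ 2) := by
  by_cases h4 : 4 * e ≤ n + g
  · have h1 : 0 ≤ 2 * n * x + n * g - 8 * e * x := by
      rcases le_total (4 * e) n with h | h
      · nlinarith [mul_nonneg (show 0 ≤ n - 4 * e by linarith) (show 0 ≤ x by linarith),
          mul_nonneg (show 0 ≤ n by linarith) (show 0 ≤ g by linarith)]
      · nlinarith [mul_nonneg (show 0 ≤ 4 * e - n by linarith) (show 0 ≤ n - 2 * x by linarith),
          mul_nonneg (show 0 ≤ n by linarith) (show 0 ≤ n + g - 4 * e by linarith)]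
    have h2 := mul_nonneg (show 0 ≤ n - g by linarith) h1
    have h3 := mul_nonneg (show 0 ≤ n by linarith)
      (mul_nonneg (show 0 ≤ 2 * x - g by linarith) (show 0 ≤ n - 2 * x by linarith))
    nlinarith
  · have hn : n ≤ 12 := by omega
    have : e ≤ 3 := by omega
    have : 3 ≤ n := by omega
    have hx0 : x ≤ 6 := by omega
    have hx1 : 1 ≤ x := by omega
    interval_cases e <;> interval_cases n <;> first
      | omega
      | (have : g ≤ 7 := by omega
         have : 1 ≤ g := by omega
         interval_cases g <;> first
          | omega
          | (interval_cases x <;> omega))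

lemma ar_case2 (n g e x : ℤ) (he : 2 ≤ e) (he5 : 5 * e ≤ n + 7) (hg5 : n + 2 ≤ 5 * g)
    (hN1 : n + g + 2 * e < 4 * x) (hN : n + g + 2 * e < 4 * (n - x)) :
    4 * (n - g) * e ≤ 4 * x * (n - x) - g ^ 2 := by
  have h1 : 0 ≤ (4 * x - (n + g + 2 * e) - 1) * (4 * (n - x) - (n + g + 2 * e) - 1) :=
    mul_nonneg (by linarith) (by linarith)
  have hb : 0 ≤ n - 2 * e - 1 - g := by linarith
  have h2 : 0 ≤ (5 * g - n - 2) * (n - 2 * e - 1 - g) := mul_nonneg (by linarith) hb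
  by_cases hex : n = 13 ∧ e = 4
  · obtain ⟨rfl, rfl⟩ := hex
    omega
  by_cases hex3 : n ≤ 15 ∧ e = 3
  · obtain ⟨hn, rfl⟩ := hex3
    have : 8 ≤ n := by omega
    have : g ≤ 8 := by omega
    have : 1 ≤ g := by omega
    clear h1 h2
    interval_cases n <;> interval_cases g <;> first
      | omega
      | (have : x ≤ 15 := by omega
         have : 0 ≤ x := by omega
         interval_cases x <;> omega)
  have hF : 0 ≤ (n - g) * (3 * n + 5 * g - 12 * e) - 4 * e ^ 2 + (2 * n - 2 * g - 4 * e) - 1 := by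
    have hL : 0 ≤ (n - g) * (3 * n + 5 * g - 12 * e) - 4 * e ^ 2 + (2 * n - 2 * g - 4 * e) - 1
        - (5 * g - n - 2) * (n - 2 * e - 1 - g) := by
      by_cases h5 : 5 ≤ e
      · nlinarith [mul_nonneg hb (show 0 ≤ n - 5 * e + 7 by linarith),
          mul_nonneg (show 0 ≤ n - 5 * e + 7 by linarith) (show 0 ≤ e - 5 by linarith),
          mul_nonneg hb (show 0 ≤ e - 5 by linarith),
          mul_nonneg (show 0 ≤ 5 * g - n - 2 by linarith) (show 0 ≤ e - 5 by linarith),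
          mul_nonneg (show 0 ≤ 5 * g - n - 2 by linarith) (show 0 ≤ n - 5 * e + 7 by linarith),
          mul_nonneg (show 0 ≤ e - 5 by linarith) (show 0 ≤ e - 5 by linarith)]
      · have : e = 2 ∨ e = 3 ∨ e = 4 := by omega
        rcases this with rfl | rfl | rfl
        · nlinarith [mul_nonneg hb (show 0 ≤ n - 7 by omega),
            mul_nonneg (show 0 ≤ 5 * g - n - 2 by linarith) (show 0 ≤ n - 7 by omega)]
        · have h16 : 0 ≤ n - 16 := by omega
          have h7 := mul_nonneg hb h16
          clear h1 h2
          ring_nf at h7 ⊢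
          linarith
        · nlinarith [mul_nonneg hb (show 0 ≤ n - 14 by omega),
            mul_nonneg (show 0 ≤ 5 * g - n - 2 by linarith) (show 0 ≤ n - 14 by omega)]
    linarith
  nlinarith
noncomputable def arCut {W ι : Type*} [Fintype W] [DecidableEq W] [DecidableEq ι] (π : W → ι)
    (X : Finset W) : ℤ :=
  ∑ u ∈ X, ((Finset.univ.filter fun v => v ∉ X ∧ π v ≠ π u).card : ℤ)

lemma arCut_eq {W ι : Type*} [Fintype W] [DecidableEq W] [Fintype ι] [DecidableEq ι] (π : W → ι)
    (X : Finset W) :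
    arCut π X = (X.card : ℤ) * ((Fintype.card W : ℤ) - X.card) -
      ∑ i, ((X.filter fun u => π u = i).card : ℤ) *
        (((Finset.univ.filter fun u => π u = i).card : ℤ) - (X.filter fun u => π u = i).card) := by
  have h1 : ∀ u, ((Finset.univ.filter fun v => v ∉ X ∧ π v ≠ π u).card : ℤ) =
      ((Fintype.card W : ℤ) - X.card) -
      (((Finset.univ.filter fun v => π v = π u).card : ℤ) - (X.filter fun v => π v = π u).card) := by
    intro u
    have a1 := Finset.card_filter_add_card_filter_not (s := Xᶜ) (fun v => π v = π u)
    have a2 := Finset.card_filter_add_card_filter_not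
      (s := Finset.univ.filter fun v => π v = π u) (fun v => v ∈ X)
    have a3 := Finset.card_compl_add_card X
    have e1 : (Finset.univ.filter fun v => v ∉ X ∧ π v ≠ π u) = Xᶜ.filter (fun v => ¬ π v = π u) := by
      ext; simp
    have e2 : ((Finset.univ.filter fun v => π v = π u).filter fun v => v ∈ X) =
        X.filter fun v => π v = π u := by ext; simp [and_comm]
    have e3 : ((Finset.univ.filter fun v => π v = π u).filter fun v => ¬ v ∈ X) =
        Xᶜ.filter fun v => π v = π u := by ext; simp [and_comm]
    rw [e1]
    rw [e2, e3] at a2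
    omega
  unfold arCut
  rw [Finset.sum_congr rfl (fun u _ => h1 u), Finset.sum_sub_distrib, Finset.sum_const,
    nsmul_eq_mul]
  congr 1
  rw [← Finset.sum_fiberwise X π]
  refine Finset.sum_congr rfl fun i _ => ?_
  rw [← nsmul_eq_mul, ← Finset.sum_const]
  refine Finset.sum_congr rfl fun u hu => ?_
  rw [(Finset.mem_filter.1 hu).2]

lemma arCut_compl {W ι : Type*} [Fintype W] [DecidableEq W] [Fintype ι] [DecidableEq ι] (π : W → ι)
    (X : Finset W) : arCut π Xᶜ = arCut π X := by
  rw [arCut_eq, arCut_eq]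
  have a3 := Finset.card_compl_add_card X
  have : ∀ i, ((Xᶜ.filter fun u => π u = i).card : ℤ) =
    ((Finset.univ.filter fun u => π u = i).card : ℤ) - (X.filter fun u => π u = i).card := by
    intro i
    have a2 := Finset.card_filter_add_card_filter_not
      (s := Finset.univ.filter fun v => π v = i) (fun v => v ∈ X)
    have e2 : ((Finset.univ.filter fun v => π v = i).filter fun v => v ∈ X) =
        X.filter fun v => π v = i := by ext; simp [and_comm]
    have e3 : ((Finset.univ.filter fun v => π v = i).filter fun v => ¬ v ∈ X) =
        Xᶜ.filter fun v => π v = i := by ext; simp [and_comm]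
    rw [e2, e3] at a2
    omega
  have e : (Xᶜ.card : ℤ) = Fintype.card W - X.card := by omega
  rw [e]
  congr 1
  · ring
  · refine Finset.sum_congr rfl fun i _ => ?_
    rw [this]; ring

lemma ar_count {W ι β : Type*} [Fintype W] [DecidableEq W] [Fintype ι] [DecidableEq ι]
    [Fintype β] [DecidableEq β] (π : W → ι) (cls : W → β) (i0 : ι) (n p s h d : ℤ)
    (hn : n = Fintype.card W) (hpp : p = (Finset.univ.filter fun u => π u = i0).card)
    (hns : n = p + s) (hs1 : 1 ≤ s) (hh1 : 1 ≤ h) (hhs : h ≤ s)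
    (hh : ∀ i, i ≠ i0 → ((Finset.univ.filter fun u => π u = i).card : ℤ) ≤ h)
    (hd0 : 0 ≤ d) (hd : 5 * d + 3 ≤ n) (hg5 : n + 2 ≤ 5 * (p - h)) (b0 b1 : β)
    (hsz : ((Finset.univ.filter fun u => cls u = b0).card : ℤ) +
      (Finset.univ.filter fun u => cls u = b1).card + d + 1 ≤ n)
    (h10 : (Finset.univ.filter fun u => cls u = b1).card ≤
      (Finset.univ.filter fun u => cls u = b0).card)
    (h1 : 1 ≤ (Finset.univ.filter fun u => cls u = b1).card)
    (hb1 : ∀ b, b ≠ b0 → (Finset.univ.filter fun u => cls u = b).card ≤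
      (Finset.univ.filter fun u => cls u = b1).card) :
    2 * (d + 2) * s ≤
      ∑ u, ((Finset.univ.filter fun v => cls v ≠ cls u ∧ π v ≠ π u).card : ℤ) := by
  set F : β → Finset W := fun b => Finset.univ.filter fun u => cls u = b with hF
  set J : Finset W → ℤ := fun X => ∑ i ∈ Finset.univ.erase i0, ((X.filter fun u => π u = i).card : ℤ)
    with hJ
  have hJ0 : ∀ X, 0 ≤ J X := fun X => Finset.sum_nonneg fun i _ => Int.natCast_nonneg _
  have hxs : ∀ X : Finset W, (X.card : ℤ) = ((X.filter fun u => π u = i0).card : ℤ) + J X := by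
    intro X
    rw [hJ, Finset.add_sum_erase _ (fun i => ((X.filter fun u => π u = i).card : ℤ))
      (Finset.mem_univ i0)]
    rw [Finset.card_eq_sum_card_fiberwise (f := π) (t := Finset.univ) (by intro x _; simp)]
    push_cast; rfl
  have hPs : ∑ i ∈ Finset.univ.erase i0, ((Finset.univ.filter fun u => π u = i).card : ℤ) = s := by
    have := hxs Finset.univ
    rw [Finset.card_univ] at this
    simp only [hJ] at this
    linarith
  have hcut : ∀ X, arCut π X = (((X.filter fun u => π u = i0).card : ℤ) + J X) *
      ((p + s) - (((X.filter fun u => π u = i0).card : ℤ) + J X)) -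
      ((X.filter fun u => π u = i0).card : ℤ) * (p - (X.filter fun u => π u = i0).card) -
      ∑ i ∈ Finset.univ.erase i0, ((X.filter fun u => π u = i).card : ℤ) *
        (((Finset.univ.filter fun u => π u = i).card : ℤ) - (X.filter fun u => π u = i).card) := by
    intro X
    rw [arCut_eq, ← hxs X, ← hns, hn, hpp, ← Finset.add_sum_erase _ _ (Finset.mem_univ i0)]
    ring
  have hle : ∀ X : Finset W, ∀ i, ((X.filter fun u => π u = i).card : ℤ) ≤
      (Finset.univ.filter fun u => π u = i).card := by
    intro X i
    exact_mod_cast Finset.card_le_card (Finset.filter_subset_filter _ (Finset.subset_univ _))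
  have F1 : ∀ X : Finset W, s * (4 * X.card * (n - X.card) - (p - h) ^ 2) ≤
      4 * (s + h) * arCut π X := by
    intro X
    have := num_F1 (Finset.univ.erase i0) (fun i => ((X.filter fun u => π u = i).card : ℤ))
      (fun i => ((Finset.univ.filter fun u => π u = i).card : ℤ))
      ((X.filter fun u => π u = i0).card : ℤ) (J X) p s h (by omega) (by omega)
      (fun _ _ => Int.natCast_nonneg _) (fun i _ => hle X i)
      (fun i hi => hh i (Finset.ne_of_mem_erase hi)) rfl hPs (arCut π X) (hcut X)
    rw [← hxs X, ← hns] at this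
    exact this
  have F2 : ∀ X : Finset W, X.card * s + J X * (p - h) - J X * (2 * X.card - J X - 1) ≤
      arCut π X := by
    intro X
    have := num_F2 (Finset.univ.erase i0) (fun i => ((X.filter fun u => π u = i).card : ℤ))
      (fun i => ((Finset.univ.filter fun u => π u = i).card : ℤ))
      ((X.filter fun u => π u = i0).card : ℤ) (J X) p s h
      (fun _ _ => Int.natCast_nonneg _)
      (fun i hi => hh i (Finset.ne_of_mem_erase hi)) rfl (arCut π X) (hcut X)
    rw [← hxs X] at this
    exact this
  have hN : ∑ u, ((Finset.univ.filter fun v => cls v ≠ cls u ∧ π v ≠ π u).card : ℤ) =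
      ∑ b, arCut π (F b) := by
    rw [← Finset.sum_fiberwise Finset.univ cls]
    refine Finset.sum_congr rfl fun b _ => ?_
    unfold arCut
    refine Finset.sum_congr rfl fun u hu => ?_
    simp only [hF, Finset.mem_filter, Finset.mem_univ, true_and] at hu ⊢
    rw [hu]
  have hNs : ∑ b, arCut π (F b) = arCut π (F b0) + ∑ b ∈ Finset.univ.erase b0, arCut π (F b) :=
    (Finset.add_sum_erase _ _ (Finset.mem_univ b0)).symm
  have hsumx : ∑ b, ((F b).card : ℤ) = n := by
    rw [hn, ← Finset.card_univ,
      Finset.card_eq_sum_card_fiberwise (f := cls) (t := Finset.univ) (by intro x _; simp)]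
    push_cast; rfl
  have hsumx' : ∑ b ∈ Finset.univ.erase b0, ((F b).card : ℤ) = n - (F b0).card := by
    rw [← hsumx, ← Finset.add_sum_erase _ _ (Finset.mem_univ b0)]; ring
  have hcc : (((F b0)ᶜ).card : ℤ) = n - (F b0).card := by
    have := Finset.card_compl_add_card (F b0)
    omega
  have hfib : ∀ b, b ≠ b0 → ((F b).card : ℤ) ≤ (F b1).card := fun b hb => by
    exact_mod_cast hb1 b hb
  have hsz' : ((F b0).card : ℤ) + (F b1).card + d + 1 ≤ n := hsz
  have h10' : ((F b1).card : ℤ) ≤ (F b0).card := by exact_mod_cast h10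
  have h1' : (1 : ℤ) ≤ (F b1).card := by exact_mod_cast h1
  rw [hN, hNs]
  set r : ℤ := n - (F b0).card with hr
  by_cases c1 : 4 * r ≤ n + (p - h) + 2 * d + 4
  · -- case 1
    apply ar_case1 n p s h (p - h) d r (J (F b0)ᶜ) _ hns rfl hhs (by omega) (hJ0 _) (by omega)
      (by omega) c1
    have hA := F2 (F b0)ᶜ
    rw [arCut_compl, hcc] at hA
    refine add_le_add hA ?_
    have hJs : ∑ b ∈ Finset.univ.erase b0, J (F b) = J (F b0)ᶜ := by
      simp only [hJ]
      rw [Finset.sum_comm]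
      refine Finset.sum_congr rfl fun i _ => ?_
      rw [Finset.card_eq_sum_card_fiberwise (f := cls) (t := Finset.univ.erase b0)
        (by intro x hx; simpa [hF] using (Finset.mem_filter.1 hx).1)]
      push_cast
      refine Finset.sum_congr rfl fun b hb => ?_
      congr 2
      ext u
      have := Finset.ne_of_mem_erase hb
      simp only [hF, Finset.mem_filter, Finset.mem_univ, true_and, Finset.mem_compl]
      constructor
      · rintro ⟨h1, h2⟩; exact ⟨⟨h1 ▸ this, h2⟩, h1⟩
      · rintro ⟨⟨h1, h2⟩, h3⟩; exact ⟨h3, h2⟩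
    have : ∑ b ∈ Finset.univ.erase b0, (((F b).card : ℤ) * s + J (F b) * (p - h) -
        J (F b) * (2 * (r - d - 2))) ≤ ∑ b ∈ Finset.univ.erase b0, arCut π (F b) := by
      refine Finset.sum_le_sum fun b hb => le_trans ?_ (F2 (F b))
      have hx := hfib b (Finset.ne_of_mem_erase hb)
      rcases eq_or_lt_of_le (hJ0 (F b)) with h0 | h0
      · rw [← h0]; simp
      · have : J (F b) * (2 * ((F b).card : ℤ) - J (F b) - 1) ≤ J (F b) * (2 * (r - d - 2)) :=
          mul_le_mul_of_nonneg_left (by omega) h0.le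
        linarith
    rw [Finset.sum_sub_distrib, Finset.sum_add_distrib, ← Finset.sum_mul, ← Finset.sum_mul,
      ← Finset.sum_mul, hJs, hsumx'] at this
    linarith
  by_cases c2 : n + (p - h) + 2 * (d + 2) < 4 * ((F b0).card : ℤ)
  · have hge : arCut π (F b0)ᶜ ≤ ∑ b ∈ Finset.univ.erase b0, arCut π (F b) := by
      have e1 : (F b0)ᶜ = (Finset.univ.erase b0).biUnion F := by
        ext u; simp [hF]
      unfold arCut
      conv_lhs => rw [e1]
      rw [Finset.sum_biUnion]
      · refine Finset.sum_le_sum fun b hb => Finset.sum_le_sum fun u hu => ?_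
        have hb' := Finset.ne_of_mem_erase hb
        rw [← e1]
        norm_cast
        apply Finset.card_le_card
        intro v
        simp only [hF, Finset.mem_filter, Finset.mem_univ, true_and, Finset.mem_compl, not_not]
        rintro ⟨h1, h2⟩
        exact ⟨h1 ▸ hb'.symm, h2⟩
      · intro b _ b' _ hbb
        rw [Function.onFun, Finset.disjoint_left]
        intro u
        simp only [hF, Finset.mem_filter, Finset.mem_univ, true_and]
        intro h1 h2; exact hbb (h1 ▸ h2)
    rw [arCut_compl] at hge
    have hf := F1 (F b0)
    have ha := ar_case2 n (p - h) (d + 2) (F b0).card (by omega) (by omega) (by omega) c2 (by omega)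
    have h3 : s * (4 * (n - (p - h)) * (d + 2)) ≤ 4 * (s + h) * arCut π (F b0) :=
      le_trans (mul_le_mul_of_nonneg_left ha (by omega)) hf
    have h4 : (4 * (s + h)) * ((d + 2) * s) ≤ (4 * (s + h)) * arCut π (F b0) := by
      have : n - (p - h) = s + h := by omega
      rw [this] at h3
      linarith
    have h5 := le_of_mul_le_mul_left h4 (by omega)
    linarith
  · rw [← hNs]
    have hn0 : 0 < n := by omega
    have hAll : ∀ b, ((F b).card : ℤ) ≤ (F b0).card := by
      intro b
      by_cases hbb : b = b0
      · rw [hbb]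
      · exact (hfib b hbb).trans h10'
    have key : ∀ b ∈ Finset.univ, (2 * (d + 2) * s) * ((F b).card : ℤ) ≤ n * arCut π (F b) := by
      intro b _
      have hx := hAll b
      have hx0 : (0 : ℤ) ≤ (F b).card := Int.natCast_nonneg _
      by_cases hxg : 2 * ((F b).card : ℤ) ≤ p - h
      · have h2 := F2 (F b)
        have h3 : 0 ≤ J (F b) * ((p - h) - (2 * (F b).card - J (F b) - 1)) :=
          mul_nonneg (hJ0 _) (by linarith [hJ0 (F b)])
        have h4 : ((F b).card : ℤ) * s ≤ arCut π (F b) := by linarith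
        have h5 : 2 * (d + 2) ≤ n := by omega
        have h6 := mul_le_mul h5 h4 (mul_nonneg hx0 (by omega)) hn0.le
        linarith
      · have hf := F1 (F b)
        have ha := ar_case3 n (p - h) (d + 2) (F b).card (by omega) (by omega) (by omega)
          (by omega) (by omega) (by omega) (by omega)
        have e : n - (p - h) = s + h := by omega
        rw [e] at ha
        have h2 := mul_le_mul_of_nonneg_left ha (show 0 ≤ s by omega)
        have h3 := mul_le_mul_of_nonneg_left hf hn0.le
        have h4 : (4 * (s + h)) * ((2 * (d + 2) * s) * ((F b).card : ℤ)) ≤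
          (4 * (s + h)) * (n * arCut π (F b)) := by nlinarith
        exact le_of_mul_le_mul_left h4 (by omega)
    have h6 := Finset.sum_le_sum key
    rw [← Finset.mul_sum, ← Finset.mul_sum, hsumx, mul_comm] at h6
    exact le_of_mul_le_mul_left h6 hn0

noncomputable def arSz {W : Type*} (H : SimpleGraph W) (v : W) : ℕ := {u | H.Reachable v u}.ncard

abbrev arH {W : Type*} (R : Set (Sym2 W)) : SimpleGraph W := SimpleGraph.fromEdgeSet R

lemma arSz_congr {W : Type*} {H : SimpleGraph W} {a b : W} (h : H.Reachable a b) :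
    arSz H a = arSz H b := by
  unfold arSz
  congr 1
  ext u
  exact ⟨fun h' => h.symm.trans h', fun h' => h.trans h'⟩

lemma arH_mono {W : Type*} {R R' : Set (Sym2 W)} (h : R ⊆ R') : arH R ≤ arH R' :=
  SimpleGraph.fromEdgeSet_mono h

lemma arSz_pos {W : Type*} [Finite W] (H : SimpleGraph W) (v : W) : 1 ≤ arSz H v :=
  (Set.ncard_pos (Set.toFinite _)).2 ⟨v, SimpleGraph.Reachable.refl v⟩

lemma ar_lemD {W : Type*} {R : Set (Sym2 W)} {x y w v : W} (h : (arH R).Reachable w v) :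
    (arH (R \ {s(x, y)})).Reachable w v ∨
    ((arH (R \ {s(x, y)})).Reachable w x ∧ (arH (R \ {s(x, y)})).Reachable y v) ∨
    ((arH (R \ {s(x, y)})).Reachable w y ∧ (arH (R \ {s(x, y)})).Reachable x v) := by
  rw [SimpleGraph.reachable_iff_reflTransGen] at h
  induction h with
  | refl => exact Or.inl (SimpleGraph.Reachable.refl _)
  | @tail a b _ hab ih =>
    rw [SimpleGraph.fromEdgeSet_adj] at hab
    by_cases he : s(a, b) = s(x, y)
    · rw [Sym2.eq_iff] at he
      rcases he with ⟨rfl, rfl⟩ | ⟨rfl, rfl⟩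
      · rcases ih with ih | ih | ih
        · exact Or.inr (Or.inl ⟨ih, SimpleGraph.Reachable.refl _⟩)
        · exact Or.inr (Or.inl ⟨ih.1, SimpleGraph.Reachable.refl _⟩)
        · exact Or.inl ih.1
      · rcases ih with ih | ih | ih
        · exact Or.inr (Or.inr ⟨ih, SimpleGraph.Reachable.refl _⟩)
        · exact Or.inl ih.1
        · exact Or.inr (Or.inr ⟨ih.1, SimpleGraph.Reachable.refl _⟩)
    · have hK : (arH (R \ {s(x, y)})).Reachable a b :=
        SimpleGraph.Adj.reachable ((SimpleGraph.fromEdgeSet_adj _).2 ⟨⟨hab.1, he⟩, hab.2⟩)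
      rcases ih with ih | ih | ih
      · exact Or.inl (ih.trans hK)
      · exact Or.inr (Or.inl ⟨ih.1, ih.2.trans hK⟩)
      · exact Or.inr (Or.inr ⟨ih.1, ih.2.trans hK⟩)

lemma ar_S2 {W : Type*} [Finite W] {R : Set (Sym2 W)} {x y : W} (hxy : s(x, y) ∈ R)
    (hn : ¬ (arH (R \ {s(x, y)})).Reachable x y) :
    arSz (arH R) x = arSz (arH (R \ {s(x, y)})) x + arSz (arH (R \ {s(x, y)})) y ∧
    (∀ v, (arH R).Reachable x v ↔ (arH (R \ {s(x, y)})).Reachable x v ∨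
      (arH (R \ {s(x, y)})).Reachable y v) ∧
    (∀ v, ¬ (arH R).Reachable x v → arSz (arH (R \ {s(x, y)})) v = arSz (arH R) v) := by
  have hle : arH (R \ {s(x, y)}) ≤ arH R := arH_mono Set.sdiff_subset
  have hne : x ≠ y := fun h => hn (h ▸ SimpleGraph.Reachable.refl _)
  have hH : (arH R).Reachable x y :=
    SimpleGraph.Adj.reachable ((SimpleGraph.fromEdgeSet_adj _).2 ⟨hxy, hne⟩)
  have key : ∀ v, (arH R).Reachable x v ↔ (arH (R \ {s(x, y)})).Reachable x v ∨
      (arH (R \ {s(x, y)})).Reachable y v := by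
    intro v
    constructor
    · intro h
      rcases ar_lemD (x := x) (y := y) h with h | h | h
      · exact Or.inl h
      · exact Or.inr h.2
      · exact Or.inl h.2
    · rintro (h | h)
      · exact h.mono hle
      · exact hH.trans (h.mono hle)
  refine ⟨?_, key, ?_⟩
  · unfold arSz
    rw [← Set.ncard_union_eq _ (Set.toFinite _) (Set.toFinite _)]
    · congr 1
      ext v; exact key v
    · rw [Set.disjoint_left]
      intro v h1 h2
      exact hn (SimpleGraph.Reachable.trans h1 (SimpleGraph.Reachable.symm h2))
  · intro v hv
    unfold arSz
    congr 1
    ext u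
    constructor
    · intro h; exact SimpleGraph.Reachable.mono hle h
    · intro h
      rcases ar_lemD (x := x) (y := y) h with h | h | h
      · exact h
      · exact absurd (h.1.mono hle).symm hv
      · exact absurd (hH.trans (h.1.mono hle).symm) hv

def arFR {W : Type*} (G : SimpleGraph W) (c : Sym2 W → ℕ) (R : Set (Sym2 W)) : Prop :=
  R ⊆ G.edgeSet ∧ Set.InjOn c R ∧ c '' R = c '' G.edgeSet

lemma ar_S {W : Type*} [Finite W] {G : SimpleGraph W} {c : Sym2 W → ℕ} {R : Set (Sym2 W)}
    (hR : arFR G c R) {w0 : W} (hmax : ∀ R' v, arFR G c R' → arSz (arH R') v ≤ arSz (arH R) w0)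
    {w u : W} (hw : (arH R).Reachable w0 w) (hu : ¬ (arH R).Reachable w0 u) (hG : G.Adj w u) :
    ∃ x y, s(x, y) ∈ R ∧ (arH R).Reachable w0 x ∧ (arH (R \ {s(x, y)})).Reachable w x ∧
      ¬ (arH (R \ {s(x, y)})).Reachable x y ∧ arSz (arH R) u ≤ arSz (arH (R \ {s(x, y)})) y := by
  obtain ⟨hRE, hinj, him⟩ := hR
  have hc : c s(w, u) ∈ c '' R := him ▸ ⟨s(w, u), hG, rfl⟩
  obtain ⟨f, hf, hcf⟩ := hc
  set R2 := insert s(w, u) (R \ {f}) with hR2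
  have hFR2 : arFR G c R2 := by
    refine ⟨?_, ?_, ?_⟩
    · intro g hg
      rcases hg with rfl | hg
      · exact hG
      · exact hRE hg.1
    · have hne : ∀ g ∈ R \ {f}, c g ≠ c s(w, u) := by
        intro g hg h
        exact hg.2 (hinj hg.1 hf (h.trans hcf.symm))
      intro g hg g' hg' h
      rcases hg with rfl | hg <;> rcases hg' with rfl | hg'
      · rfl
      · exact absurd h.symm (hne _ hg')
      · exact absurd h (hne _ hg)
      · exact hinj hg.1 hg'.1 h
    · rw [← him]
      ext t
      constructor
      · rintro ⟨g, hg, rfl⟩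
        rcases hg with rfl | hg
        · exact ⟨f, hf, hcf⟩
        · exact ⟨g, hg.1, rfl⟩
      · rintro ⟨g, hg, rfl⟩
        by_cases h : g = f
        · subst h; exact ⟨s(w, u), Set.mem_insert _ _, hcf.symm⟩
        · exact ⟨g, Set.mem_insert_of_mem _ ⟨hg, h⟩, rfl⟩
  have hm := hmax R2 w hFR2
  have hK2 : arH (R \ {f}) ≤ arH R2 := arH_mono (Set.subset_insert _ _)
  have hKH : arH (R \ {f}) ≤ arH R := arH_mono Set.sdiff_subset
  have hadj : (arH R2).Reachable w u :=
    SimpleGraph.Adj.reachable ((SimpleGraph.fromEdgeSet_adj _).2 ⟨Set.mem_insert _ _, hG.ne⟩)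
  have hwu : ¬ (arH R).Reachable w u := fun h => hu (hw.trans h)
  have hex : ∃ v, (arH R).Reachable w v ∧ ¬ (arH (R \ {f})).Reachable w v := by
    by_contra hcon
    push Not at hcon
    have : arSz (arH R) w + 1 ≤ arSz (arH R2) w := by
      unfold arSz
      rw [← Set.ncard_insert_of_notMem (a := u) (s := {v | (arH R).Reachable w v}) hwu
        (Set.toFinite _)]
      apply Set.ncard_le_ncard _ (Set.toFinite _)
      intro v hv
      rcases hv with rfl | hv
      · exact hadj
      · exact (hcon v hv).mono hK2
    rw [arSz_congr hw] at hm
    omega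
  obtain ⟨v, hv, hvK⟩ := hex
  have hxy : ∃ x y, f = s(x, y) ∧ (arH (R \ {f})).Reachable w x ∧ (arH (R \ {f})).Reachable y v := by
    induction f using Sym2.ind with
    | _ x y =>
      rcases ar_lemD (x := x) (y := y) hv with h | h | h
      · exact absurd h hvK
      · exact ⟨x, y, rfl, h⟩
      · exact ⟨y, x, Sym2.eq_swap, h⟩
  obtain ⟨x, y, rfl, hwx, hyv⟩ := hxy
  have hnxy : ¬ (arH (R \ {s(x, y)})).Reachable x y := fun h => hvK (hwx.trans (h.trans hyv))
  have hw0x : (arH R).Reachable w0 x := hw.trans (hwx.mono hKH)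
  refine ⟨x, y, hf, hw0x, hwx, hnxy, ?_⟩
  obtain ⟨s1, s2, s3⟩ := ar_S2 hf hnxy
  have h1 : arSz (arH (R \ {s(x, y)})) u = arSz (arH R) u := s3 u fun h => hu (hw0x.trans h)
  have h2 : arSz (arH (R \ {s(x, y)})) w + arSz (arH (R \ {s(x, y)})) u ≤ arSz (arH R2) w := by
    unfold arSz
    rw [← Set.ncard_union_eq _ (Set.toFinite _) (Set.toFinite _)]
    · apply Set.ncard_le_ncard _ (Set.toFinite _)
      rintro z (hz | hz)
      · exact SimpleGraph.Reachable.mono hK2 hz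
      · exact hadj.trans (SimpleGraph.Reachable.mono hK2 hz)
    · rw [Set.disjoint_left]
      intro z h1 h2
      exact hwu ((SimpleGraph.Reachable.mono hKH h1).trans
        (SimpleGraph.Reachable.mono hKH h2).symm)
  have h3 := arSz_congr hwx
  have h4 := arSz_congr hw0x
  omega

lemma ar_comb {W : Type*} [Finite W] [Nonempty W] (G : SimpleGraph W) (c : Sym2 W → ℕ) (q : ℕ)
    (hG : ∀ u u' w, G.Adj u u' → G.Adj w u ∨ G.Adj w u') (hiso : ∀ w, ∃ w', G.Adj w w')
    (hq : q < Nat.card W) (hno : ∀ R v, arFR G c R → arSz (arH R) v ≤ q) :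
    ∃ R', R' ⊆ G.edgeSet ∧ R'.ncard + 1 = (c '' G.edgeSet).ncard ∧ ∃ a0 a1,
      ¬ (arH R').Reachable a0 a1 ∧ arSz (arH R') a1 ≤ arSz (arH R') a0 ∧
      arSz (arH R') a0 + arSz (arH R') a1 ≤ q ∧
      ∀ v, ¬ (arH R').Reachable a0 v → arSz (arH R') v ≤ arSz (arH R') a1 := by
  obtain ⟨R0, hR0, hbij⟩ := Set.exists_subset_bijOn G.edgeSet c
  have : Nonempty {z : Set (Sym2 W) × W // arFR G c z.1} :=
    ⟨⟨(R0, Classical.arbitrary W), hR0, hbij.injOn, hbij.image_eq⟩⟩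
  obtain ⟨⟨⟨R, w0⟩, hR⟩, hmax⟩ := Finite.exists_max
    (fun z : {z : Set (Sym2 W) × W // arFR G c z.1} => arSz (arH z.1.1) z.1.2)
  simp only at hR
  replace hmax : ∀ R' v, arFR G c R' → arSz (arH R') v ≤ arSz (arH R) w0 :=
    fun R' v h => hmax ⟨(R', v), h⟩
  have hb := hno R w0 hR
  have hout : ∃ u, ¬ (arH R).Reachable w0 u := by
    by_contra hcon
    push Not at hcon
    have : {u | (arH R).Reachable w0 u} = Set.univ := by ext u; simp [hcon u]
    rw [arSz, this, Set.ncard_univ] at hb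
    omega
  have : Nonempty {u // ¬ (arH R).Reachable w0 u} := ⟨⟨_, hout.choose_spec⟩⟩
  obtain ⟨⟨u1, hu1⟩, hu1max⟩ := Finite.exists_max
    (fun z : {u // ¬ (arH R).Reachable w0 u} => arSz (arH R) z.1)
  replace hu1max : ∀ u, ¬ (arH R).Reachable w0 u → arSz (arH R) u ≤ arSz (arH R) u1 :=
    fun u h => hu1max ⟨u, h⟩
  have key : ∃ x y, s(x, y) ∈ R ∧ (arH R).Reachable w0 x ∧ ¬ (arH (R \ {s(x, y)})).Reachable x y ∧
      arSz (arH R) u1 ≤ arSz (arH (R \ {s(x, y)})) y ∧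
      arSz (arH (R \ {s(x, y)})) y ≤ arSz (arH (R \ {s(x, y)})) x := by
    by_cases h1 : arSz (arH R) u1 = 1
    · have hcross : ∃ w u, (arH R).Reachable w0 w ∧ ¬ (arH R).Reachable w0 u ∧ G.Adj w u := by
        obtain ⟨w', hw'⟩ := hiso w0
        by_cases hr : (arH R).Reachable w0 w'
        · rcases hG _ _ u1 hw' with h | h
          · exact ⟨w0, u1, SimpleGraph.Reachable.refl _, hu1, h.symm⟩
          · exact ⟨w', u1, hr, hu1, h.symm⟩
        · exact ⟨w0, w', SimpleGraph.Reachable.refl _, hr, hw'⟩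
      obtain ⟨w, u, hw, hu, hwu⟩ := hcross
      obtain ⟨x, y, hxy, hx, hwx, hn, hs⟩ := ar_S hR hmax hw hu hwu
      rcases le_total (arSz (arH (R \ {s(x, y)})) y) (arSz (arH (R \ {s(x, y)})) x) with h | h
      · exact ⟨x, y, hxy, hx, hn, h1 ▸ arSz_pos _ _, h⟩
      · refine ⟨y, x, ?_⟩
        rw [Sym2.eq_swap]
        refine ⟨hxy, ?_, fun h' => hn h'.symm, h1 ▸ arSz_pos _ _, h⟩
        have hne : x ≠ y := fun h => hn (h ▸ SimpleGraph.Reachable.refl _)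
        exact hx.trans (SimpleGraph.Adj.reachable ((SimpleGraph.fromEdgeSet_adj _).2 ⟨hxy, hne⟩))
    · have hu2 : ∃ u2, (arH R).Adj u1 u2 := by
        by_contra hcon
        push Not at hcon
        apply h1
        have : {u | (arH R).Reachable u1 u} = {u1} := by
          ext u
          constructor
          · rintro ⟨p⟩
            cases p with
            | nil => rfl
            | cons h p => exact absurd h (hcon _)
          · rintro rfl; exact SimpleGraph.Reachable.refl _
        rw [arSz, this, Set.ncard_singleton]
      obtain ⟨u2, hu2⟩ := hu2
      have hGu : G.Adj u1 u2 := hR.1 ((SimpleGraph.fromEdgeSet_adj _).1 hu2).1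
      have hS : ∀ w, (arH R).Reachable w0 w → ∃ x y, s(x, y) ∈ R ∧ (arH R).Reachable w0 x ∧
          (arH (R \ {s(x, y)})).Reachable w x ∧ ¬ (arH (R \ {s(x, y)})).Reachable x y ∧
          arSz (arH R) u1 ≤ arSz (arH (R \ {s(x, y)})) y := by
        intro w hw
        rcases hG _ _ w hGu with h | h
        · exact ar_S hR hmax hw hu1 h
        · rw [arSz_congr hu2.reachable]
          exact ar_S hR hmax hw (fun h' => hu1 (h'.trans hu2.reachable.symm)) h
      let good : W × W → Prop := fun z => s(z.1, z.2) ∈ R ∧ (arH R).Reachable w0 z.1 ∧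
        ¬ (arH (R \ {s(z.1, z.2)})).Reachable z.1 z.2 ∧
        arSz (arH R) u1 ≤ arSz (arH (R \ {s(z.1, z.2)})) z.2
      obtain ⟨x0, y0, g1, g2, -, g3, g4⟩ := hS w0 (SimpleGraph.Reachable.refl _)
      have : Nonempty {z // good z} := ⟨⟨(x0, y0), g1, g2, g3, g4⟩⟩
      obtain ⟨⟨⟨x, y⟩, hgood⟩, hm⟩ := Finite.exists_max
        (fun z : {z // good z} => arSz (arH (R \ {s(z.1.1, z.1.2)})) z.1.1)
      simp only at hm
      obtain ⟨hxy, hx, hn, hs⟩ := id hgood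
      simp only at hxy hx hn hs
      refine ⟨x, y, hxy, hx, hn, hs, ?_⟩
      by_contra hlt
      push Not at hlt
      have hne : x ≠ y := fun h => hn (h ▸ SimpleGraph.Reachable.refl _)
      have hHxy : (arH R).Reachable x y :=
        SimpleGraph.Adj.reachable ((SimpleGraph.fromEdgeSet_adj _).2 ⟨hxy, hne⟩)
      obtain ⟨x', y', hxy', hx', hyx', hn', hs'⟩ := hS y (hx.trans hHxy)
      have hm' := hm ⟨(x', y'), hxy', hx', hn', hs'⟩
      simp only at hm'
      rw [← arSz_congr hyx'] at hm'
      by_cases heq : s(x', y') = s(x, y)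
      · rw [heq] at hm'; omega
      · have hne' : x' ≠ y' := fun h => hn' (h ▸ SimpleGraph.Reachable.refl _)
        have hK'xy : (arH (R \ {s(x', y')})).Reachable y x :=
          SimpleGraph.Adj.reachable (SimpleGraph.Adj.symm
            ((SimpleGraph.fromEdgeSet_adj _).2 ⟨⟨hxy, fun h => heq h.symm⟩, hne⟩))
        have hKxy' : (arH (R \ {s(x, y)})).Reachable x' y' :=
          SimpleGraph.Adj.reachable
            ((SimpleGraph.fromEdgeSet_adj _).2 ⟨⟨hxy', heq⟩, hne'⟩)
        have hLK : arH ((R \ {s(x, y)}) \ {s(x', y')}) ≤ arH (R \ {s(x, y)}) :=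
          arH_mono Set.sdiff_subset
        have hLK' : arH ((R \ {s(x, y)}) \ {s(x', y')}) ≤ arH (R \ {s(x', y')}) :=
          arH_mono fun g hg => ⟨hg.1.1, hg.2⟩
        have hstay : ∀ a, ¬ (arH (R \ {s(x, y)})).Reachable a x' → ∀ z,
            (arH (R \ {s(x, y)})).Reachable a z → (arH (R \ {s(x', y')})).Reachable a z := by
          intro a ha z hz
          rcases ar_lemD (x := x') (y := y') hz with h | h | h
          · exact h.mono hLK'
          · exact absurd (h.1.mono hLK) ha
          · exact absurd ((h.1.mono hLK).trans hKxy'.symm) ha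
        by_cases hc : (arH (R \ {s(x, y)})).Reachable y x'
        · have : arSz (arH (R \ {s(x, y)})) x + 1 ≤ arSz (arH (R \ {s(x', y')})) y := by
            unfold arSz
            rw [← Set.ncard_insert_of_notMem (a := y)
              (s := {v | (arH (R \ {s(x, y)})).Reachable x v}) hn (Set.toFinite _)]
            apply Set.ncard_le_ncard _ (Set.toFinite _)
            intro v hv
            rcases hv with rfl | hv
            · exact SimpleGraph.Reachable.refl _
            · exact hK'xy.trans (hstay x (fun h => hn (h.trans hc.symm)) v hv)
          omega
        · have : arSz (arH (R \ {s(x, y)})) y ≤ arSz (arH (R \ {s(x', y')})) y :=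
            Set.ncard_le_ncard (fun v hv => hstay y hc v hv) (Set.toFinite _)
          omega
  obtain ⟨x, y, hxy, hx, hn, hs, hle⟩ := key
  obtain ⟨s1, s2, s3⟩ := ar_S2 hxy hn
  refine ⟨R \ {s(x, y)}, fun g hg => hR.1 hg.1, ?_, x, y, hn, hle, ?_, ?_⟩
  · rw [Set.ncard_sdiff_singleton_add_one hxy (Set.toFinite _), ← hR.2.2, hR.2.1.ncard_image]
  · rw [← s1, ← arSz_congr hx]; exact hb
  · intro v hv
    by_cases h : (arH R).Reachable x v
    · rcases (s2 v).1 h with h | h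
      · exact absurd h hv
      · rw [arSz_congr h]
    · rw [s3 v h]
      exact (hu1max v fun h' => h (hx.symm.trans h')).trans hs

lemma ar_tree_card {W : Type*} [Finite W] {G : SimpleGraph W} (H : G.Subgraph) (hH : H.coe.IsTree) :
    H.edgeSet.ncard + 1 = H.verts.ncard := by
  classical
  have := Fintype.ofFinite W
  have h := hH.card_edgeFinset
  rw [← SimpleGraph.Subgraph.image_coe_edgeSet_coe,
    Set.ncard_image_of_injective _ (Sym2.map.injective Subtype.val_injective)]
  rw [← SimpleGraph.coe_edgeFinset, Set.ncard_coe_finset, h, Set.ncard_eq_toFinset_card',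
    Set.toFinset_card]

lemma ar_grow {W : Type*} [Finite W] (H : SimpleGraph W) (v : W) (m : ℕ) (hm : m + 1 ≤ arSz H v) :
    ∃ S : Set W, v ∈ S ∧ S.ncard = m + 1 ∧ (H.induce S).Connected := by
  induction m with
  | zero =>
    refine ⟨{v}, rfl, Set.ncard_singleton _, ?_⟩
    rw [SimpleGraph.induce_singleton_eq_top]
    exact SimpleGraph.connected_top
  | succ m ih =>
    obtain ⟨S, hv, hc, hS⟩ := ih (by omega)
    have : ∃ u, H.Reachable v u ∧ u ∉ S := by
      by_contra hcon
      push Not at hcon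
      have := Set.ncard_le_ncard (s := {u | H.Reachable v u}) (t := S) hcon (Set.toFinite _)
      unfold arSz at hm
      omega
    obtain ⟨u, ⟨p⟩, hu⟩ := this
    obtain ⟨dd, -, h1, h2⟩ := p.exists_boundary_dart S hv hu
    refine ⟨S ∪ {dd.fst, dd.snd}, Or.inl hv, ?_, ?_⟩
    · have : S ∪ {dd.fst, dd.snd} = insert dd.snd S := by
        ext z
        simp only [Set.mem_union, Set.mem_insert_iff, Set.mem_singleton_iff]
        constructor
        · rintro (h | rfl | rfl)
          · exact Or.inr h
          · exact Or.inr h1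
          · exact Or.inl rfl
        · rintro (rfl | h)
          · exact Or.inr (Or.inr rfl)
          · exact Or.inl h
      rw [this, Set.ncard_insert_of_notMem h2 (Set.toFinite _), hc]
    · exact SimpleGraph.induce_union_connected hS.preconnected
        (SimpleGraph.induce_pair_connected_of_adj dd.adj).preconnected ⟨dd.fst, h1, Or.inl rfl⟩

lemma ar_extract {W : Type} [Fintype W] (G : SimpleGraph W) (c : Sym2 W → ℕ) (q : ℕ)
    (R : Set (Sym2 W)) (hR : arFR G c R) (v : W) (hv : q + 1 ≤ arSz (arH R) v) :
    hasRainbowTree G c q := by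
  obtain ⟨S, -, hcard, hS⟩ := ar_grow _ _ _ hv
  obtain ⟨T, hT, hTree⟩ := hS.exists_isTree_le
  have hadj : ∀ a b (ha : a ∈ S) (hb : b ∈ S), T.Adj ⟨a, ha⟩ ⟨b, hb⟩ → s(a, b) ∈ R := by
    intro a b ha hb h
    have := hT h
    exact ((SimpleGraph.fromEdgeSet_adj _).1 this).1
  let H : G.Subgraph :=
    { verts := S
      Adj := fun a b => ∃ (ha : a ∈ S) (hb : b ∈ S), T.Adj ⟨a, ha⟩ ⟨b, hb⟩
      adj_sub := by
        rintro a b ⟨ha, hb, h⟩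
        exact hR.1 (hadj a b ha hb h)
      edge_vert := by
        rintro a b ⟨ha, hb, h⟩
        exact ha
      symm := ⟨by
        rintro a b ⟨ha, hb, h⟩
        exact ⟨hb, ha, h.symm⟩⟩ }
  have hco : H.coe = T := by
    ext a b
    constructor
    · rintro ⟨_, _, h⟩; exact h
    · intro h; exact ⟨a.2, b.2, h⟩
  have hHT : H.coe.IsTree := hco ▸ hTree
  refine ⟨H, hHT, ?_, ?_⟩
  · have h1 := ar_tree_card H hHT
    have h2 : H.verts.ncard = q + 1 := hcard
    omega
  · apply hR.2.1.mono
    intro e he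
    induction e using Sym2.ind with
    | _ a b =>
      obtain ⟨ha, hb, h⟩ := he
      exact hadj a b ha hb h

lemma ar_upper {W : Type} {ι : Type*} [Fintype W] [Fintype ι] [DecidableEq ι] (G : SimpleGraph W)
    (π : W → ι) (hadj : ∀ u v, G.Adj u v ↔ π u ≠ π v) (hiso : ∀ w, ∃ w', π w ≠ π w')
    (i0 : ι) (n p s h d : ℤ)
    (hn : n = Fintype.card W) (hpp : p = (Finset.univ.filter fun u => π u = i0).card)
    (hns : n = p + s) (hs1 : 1 ≤ s) (hh1 : 1 ≤ h) (hhs : h ≤ s)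
    (hh : ∀ i, i ≠ i0 → ((Finset.univ.filter fun u => π u = i).card : ℤ) ≤ h)
    (hd0 : 0 ≤ d) (hd : 5 * d + 3 ≤ n) (hg5 : n + 2 ≤ 5 * (p - h)) (q : ℕ) (hq : (q : ℤ) = n - 1 - d)
    (c : Sym2 W → ℕ) (t : ℕ) (hc : c '' G.edgeSet = Set.Iio t) (hno : ¬ hasRainbowTree G c q) :
    (t : ℤ) + (d + 2) * s ≤ G.edgeSet.ncard + 1 := by
  classical
  have hne : Nonempty W := by
    rw [← Fintype.card_pos_iff]; omega
  obtain ⟨R', hR'E, hcard, a0, a1, hna, h10, hsum, hall⟩ := ar_comb G c q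
    (by
      intro u u' w h
      rw [hadj] at h
      simp only [hadj]
      by_contra hcon
      push Not at hcon
      exact h (hcon.1.symm.trans hcon.2))
    (fun w => by obtain ⟨w', hw⟩ := hiso w; exact ⟨w', (hadj _ _).2 hw⟩)
    (by rw [Nat.card_eq_fintype_card]; omega)
    (fun R v hR => by
      by_contra hcon
      exact hno (ar_extract G c q R hR v (by omega)))
  rw [hc, Set.ncard_Iio_nat] at hcard
  let cls : W → (arH R').ConnectedComponent := (arH R').connectedComponentMk
  have hfib : ∀ v, (Finset.univ.filter fun u => cls u = cls v).card = arSz (arH R') v := by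
    intro v
    unfold arSz
    rw [← Set.ncard_coe_finset]
    congr 1
    ext u
    simp only [Finset.coe_filter, Finset.mem_univ, true_and, Set.mem_ofPred_eq]
    rw [show cls u = cls v ↔ (arH R').Reachable u v from SimpleGraph.ConnectedComponent.eq]
    exact ⟨fun h => h.symm, fun h => h.symm⟩
  have hcount := ar_count π cls i0 n p s h d hn hpp hns hs1 hh1 hhs hh hd0 hd hg5 (cls a0) (cls a1)
    (by rw [hfib, hfib]; omega) (by rw [hfib, hfib]; exact h10)
    (by rw [hfib]; exact arSz_pos _ _)
    (by
      intro b
      induction b using SimpleGraph.ConnectedComponent.ind with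
      | _ v =>
        intro hb
        change (Finset.univ.filter fun u => cls u = cls v).card ≤ _
        rw [hfib, hfib]
        apply hall
        intro hr
        exact hb (SimpleGraph.ConnectedComponent.eq.2 hr.symm))
  let X : SimpleGraph W :=
    { Adj := fun u v => cls v ≠ cls u ∧ π v ≠ π u
      symm := ⟨fun u v h => ⟨h.1.symm, h.2.symm⟩⟩
      loopless := ⟨fun u h => h.1 rfl⟩ }
  have hdeg : ∑ u, (Finset.univ.filter fun v => cls v ≠ cls u ∧ π v ≠ π u).card =
      2 * X.edgeFinset.card := by
    rw [← SimpleGraph.sum_degrees_eq_twice_card_edges]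
    refine Finset.sum_congr rfl fun u _ => ?_
    rw [← SimpleGraph.card_neighborFinset_eq_degree]
    congr 1
    ext v
    simp [X]
  have hX : X.edgeFinset.card ≤ (G.edgeSet \ R').ncard := by
    rw [← Set.ncard_coe_finset, SimpleGraph.coe_edgeFinset]
    apply Set.ncard_le_ncard _ (Set.toFinite _)
    intro e he
    induction e using Sym2.ind with
    | _ a b =>
      have hab : cls b ≠ cls a ∧ π b ≠ π a := he
      refine ⟨(hadj a b).2 hab.2.symm, fun hR => hab.1 ?_⟩
      refine SimpleGraph.ConnectedComponent.eq.2 (SimpleGraph.Adj.reachable ?_)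
      refine SimpleGraph.Adj.symm ((SimpleGraph.fromEdgeSet_adj _).2 ⟨hR, ?_⟩)
      rintro rfl; exact hab.1 rfl
  have hdiff := Set.ncard_sdiff_add_ncard_of_subset hR'E (Set.toFinite _)
  have h2 : (2 * (d + 2) * s : ℤ) ≤ 2 * (X.edgeFinset.card : ℤ) := by
    refine hcount.trans (le_of_eq ?_)
    exact_mod_cast hdeg
  have h3 : (d + 2) * s ≤ (X.edgeFinset.card : ℤ) := by linarith
  omega

lemma ar_index {α : Type*} (A : Set α) (hA : A.Finite) :
    ∃ f : α → ℕ, Set.BijOn f A (Set.Iio A.ncard) := by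
  classical
  have := hA.fintype
  have e := (Fintype.equivFin A)
  have hcard : Fintype.card A = A.ncard := by
    rw [Set.ncard_eq_toFinset_card', Set.toFinset_card]
  refine ⟨fun x => if h : x ∈ A then (e ⟨x, h⟩ : ℕ) else 0, ?_, ?_, ?_⟩
  · intro x hx
    simp only [hx, dif_pos, Set.mem_Iio]
    rw [← hcard]
    exact (e ⟨x, hx⟩).2
  · intro x hx y hy h
    simp only [hx, hy, dif_pos] at h
    have := e.injective (Fin.ext h)
    exact congrArg Subtype.val this
  · intro i hi
    rw [Set.mem_Iio, ← hcard] at hi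
    refine ⟨(e.symm ⟨i, hi⟩ : A), (e.symm ⟨i, hi⟩).2, ?_⟩
    simp

lemma ar_lower {W : Type} {ι : Type*} [Fintype W] [DecidableEq ι] (G : SimpleGraph W)
    (π : W → ι) (hadj : ∀ u v, G.Adj u v ↔ π u ≠ π v) (i0 : ι) (n p s d : ℕ)
    (hn : n = Fintype.card W) (hpp : p = (Finset.univ.filter fun u => π u = i0).card)
    (hns : n = p + s) (hs1 : 1 ≤ s) (hdp : d + 2 ≤ p) (q : ℕ) (hq : q + d + 1 = n) :
    ∃ M, M + (d + 2) * s = G.edgeSet.ncard ∧ ∃ c : Sym2 W → ℕ, c '' G.edgeSet = Set.Iio (M + 1) ∧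
      ¬ hasRainbowTree G c q := by
  classical
  obtain ⟨D, hDP, hD⟩ := Finset.exists_subset_card_eq (hpp ▸ hdp)
  have hDi : ∀ v ∈ D, π v = i0 := fun v hv => (Finset.mem_filter.1 (hDP hv)).2
  set S : Finset W := (Finset.univ.filter fun u => π u = i0)ᶜ with hS
  have hScard : S.card = s := by
    have := Finset.card_compl_add_card (Finset.univ.filter fun u => π u = i0)
    rw [← hS] at this
    omega
  have hSi : ∀ v ∈ S, π v ≠ i0 := fun v hv => by simpa [hS] using hv
  set F : Finset (Sym2 W) := (D ×ˢ S).image (fun z => s(z.1, z.2)) with hF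
  have hFc : F.card = (d + 2) * s := by
    rw [hF, Finset.card_image_of_injOn, Finset.card_product, hD, hScard]
    rintro ⟨a, b⟩ hab ⟨a', b'⟩ hab' h
    simp only [Finset.coe_product, Set.mem_prod, Finset.mem_coe] at hab hab'
    rw [Sym2.eq_iff] at h
    rcases h with ⟨rfl, rfl⟩ | ⟨rfl, rfl⟩
    · rfl
    · exact absurd (hDi _ hab.1) (hSi _ hab'.2)
  have hFE : (F : Set (Sym2 W)) ⊆ G.edgeSet := by
    intro e he
    obtain ⟨⟨a, b⟩, hab, rfl⟩ := Finset.mem_image.1 (Finset.mem_coe.1 he)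
    rw [Finset.mem_product] at hab
    refine (hadj a b).2 ?_
    rw [hDi _ hab.1]
    exact (hSi _ hab.2).symm
  have hdiff := Set.ncard_sdiff_add_ncard_of_subset hFE (Set.toFinite _)
  rw [Set.ncard_coe_finset, hFc] at hdiff
  obtain ⟨f, hf⟩ := ar_index (G.edgeSet \ F) (Set.toFinite _)
  set M := (G.edgeSet \ (F : Set (Sym2 W))).ncard with hM
  refine ⟨M, hdiff, fun e => if e ∈ F then M else f e, ?_, ?_⟩
  · ext i
    constructor
    · rintro ⟨e, he, rfl⟩
      by_cases h : e ∈ F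
      · simp [h]
      · have := hf.mapsTo ⟨he, h⟩
        simp only [h, if_false, Set.mem_Iio] at this ⊢
        omega
    · intro hi
      rw [Set.mem_Iio] at hi
      by_cases h : i = M
      · have : 0 < F.card := by rw [hFc]; positivity
        obtain ⟨e, he⟩ := Finset.card_pos.1 this
        exact ⟨e, hFE he, by simp [he, h]⟩
      · obtain ⟨e, he, rfl⟩ := hf.surjOn (show i ∈ Set.Iio M by rw [Set.mem_Iio]; omega)
        exact ⟨e, he.1, if_neg he.2⟩
  · rintro ⟨H, hT, hHq, hinj⟩
    have hv := ar_tree_card H hT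
    have h2 : 1 < ((D : Set W) ∩ H.verts).ncard := by
      have h3 := Set.ncard_union_add_ncard_inter (D : Set W) H.verts (Set.toFinite _) (Set.toFinite _)
      have h4 := Set.ncard_le_ncard (Set.subset_univ ((D : Set W) ∪ H.verts)) (Set.toFinite _)
      rw [Set.ncard_univ, Nat.card_eq_fintype_card] at h4
      rw [Set.ncard_coe_finset, hD] at h3
      omega
    obtain ⟨v1, v2, h1, h2, hne⟩ := (Set.one_lt_ncard_iff (Set.toFinite _)).1 h2
    have hnb : ∀ a b : H.verts, a ≠ b → ∃ w, H.Adj a w := by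
      intro a b hab
      obtain ⟨p⟩ := hT.connected.preconnected a b
      cases p with
      | nil => exact absurd rfl hab
      | @cons _ w _ h p => exact ⟨w, h⟩
    obtain ⟨w1, hw1⟩ := hnb ⟨v1, h1.2⟩ ⟨v2, h2.2⟩ (fun h => hne (congrArg Subtype.val h))
    obtain ⟨w2, hw2⟩ := hnb ⟨v2, h2.2⟩ ⟨v1, h1.2⟩ (fun h => hne (congrArg Subtype.val h).symm)
    have hin : ∀ v w, v ∈ D → H.Adj v w → s(v, w) ∈ F := by
      intro v w hv h
      refine Finset.mem_image.2 ⟨(v, w), Finset.mem_product.2 ⟨hv, ?_⟩, rfl⟩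
      have h' := (hadj v w).1 (H.adj_sub h)
      rw [hDi v hv] at h'
      simpa [hS] using h'.symm
    have he1 := hin v1 w1 h1.1 hw1
    have he2 := hin v2 w2 h2.1 hw2
    have heq : s(v1, w1) = s(v2, w2) := hinj hw1 hw2 (by simp only [he1, he2, if_true])
    rw [Sym2.eq_iff] at heq
    rcases heq with ⟨h, _⟩ | ⟨h, h'⟩
    · exact hne h
    · have h5 := (hadj _ _).1 (H.adj_sub hw1)
      apply h5
      change π v1 = π w1
      rw [hDi _ h1.1, h', hDi _ h2.1]

/-- Let `G = K_{p₁,…,p_k}` with `k ≥ 2`, `p₁ ≥ ⋯ ≥ p_k ≥ 1` and `n = p₁ + ⋯ + p_k`.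
If `(4n−2)/5 ≤ q ≤ n−1` and `p₁ − p₂ ≥ (n+2)/5`, then
`ar(G, 𝒯_q) = |E(G)| + 1 − (n−q+1)(n−p₁)`. -/
theorem stmt19 (k : ℕ) (hk : 2 ≤ k) (p : Fin k → ℕ) (hmono : Antitone p)
    (hp : ∀ i, 1 ≤ p i) (n : ℕ) (hn : n = ∑ i, p i)
    (q : ℕ) (hqlow : (4 * n - 2 : ℝ) / 5 ≤ q) (hqhigh : q ≤ n - 1)
    (hgap : ((n + 2 : ℝ)) / 5 ≤ (p ⟨0, by omega⟩ : ℝ) - p ⟨1, by omega⟩) :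
    ar (completeMultipartiteGraph fun i : Fin k => Fin (p i)) q =
      (completeMultipartiteGraph fun i : Fin k => Fin (p i)).edgeSet.ncard + 1 -
        (n - q + 1) * (n - p ⟨0, by omega⟩) := by
  have hq1 : (4 * n - 2 : ℝ) ≤ 5 * q := by linarith
  have hq2 : (4 * n : ℝ) ≤ 5 * q + 2 := by linarith
  have hq3 : 4 * n ≤ 5 * q + 2 := by exact_mod_cast hq2
  have hg1 : (n + 2 : ℝ) + 5 * p ⟨1, by omega⟩ ≤ 5 * p ⟨0, by omega⟩ := by linarith
  have hg2 : n + 2 + 5 * p ⟨1, by omega⟩ ≤ 5 * p ⟨0, by omega⟩ := by exact_mod_cast hg1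
  set i0 : Fin k := ⟨0, by omega⟩ with hi0
  set i1 : Fin k := ⟨1, by omega⟩ with hi1
  have hi01 : i1 ≠ i0 := by simp [hi0, hi1]
  have hsplit : n = p i0 + ∑ i ∈ Finset.univ.erase i0, p i := by
    rw [hn, Finset.add_sum_erase _ _ (Finset.mem_univ i0)]
  have hle1 : p i1 ≤ ∑ i ∈ Finset.univ.erase i0, p i :=
    Finset.single_le_sum (f := p) (fun _ _ => Nat.zero_le _)
      (Finset.mem_erase.2 ⟨hi01, Finset.mem_univ _⟩)
  have hp1 := hp i1
  set s := ∑ i ∈ Finset.univ.erase i0, p i with hs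
  have hcardW : n = Fintype.card (Σ i : Fin k, Fin (p i)) := by simp [hn]
  have hfibc : ∀ i, (Finset.univ.filter fun u : (Σ i : Fin k, Fin (p i)) => u.1 = i).card = p i := by
    intro i
    have : (Finset.univ.filter fun u : (Σ i : Fin k, Fin (p i)) => u.1 = i) =
        Finset.univ.map (Function.Embedding.sigmaMk i) := by
      ext ⟨j, x⟩
      simp only [Finset.mem_filter, Finset.mem_univ, true_and, Finset.mem_map,
        Function.Embedding.sigmaMk_apply]
      constructor
      · rintro rfl; exact ⟨x, rfl⟩
      · rintro ⟨y, hy⟩; exact (congrArg Sigma.fst hy).symm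
    rw [this, Finset.card_map, Finset.card_univ, Fintype.card_fin]
  set G := completeMultipartiteGraph fun i : Fin k => Fin (p i) with hG
  have hadj : ∀ u v, G.Adj u v ↔ u.1 ≠ v.1 := fun u v => Iff.rfl
  obtain ⟨d, hd⟩ : ∃ d, q + d + 1 = n := ⟨n - 1 - q, by omega⟩
  obtain ⟨M, hM, c, hc, hno⟩ := ar_lower G Sigma.fst hadj i0 n (p i0) s d hcardW (hfibc i0).symm
    hsplit (by omega) (by omega) q hd
  have e1 : n - q + 1 = d + 2 := by omega
  have e2 : n - p i0 = s := by omega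
  rw [e1, e2]
  have e3 : G.edgeSet.ncard + 1 - (d + 2) * s = M + 1 := by omega
  rw [e3]
  have hgr : IsGreatest {t | ∃ c : Sym2 (Σ i : Fin k, Fin (p i)) → ℕ,
      c '' G.edgeSet = Set.Iio t ∧ ¬ hasRainbowTree G c q} (M + 1) := by
    refine ⟨⟨c, hc, hno⟩, ?_⟩
    rintro t ⟨c', hc', hno'⟩
    have := ar_upper G Sigma.fst hadj
      (by
        intro w
        by_cases hw : w.1 = i0
        · exact ⟨⟨i1, ⟨0, hp i1⟩⟩, by rw [hw]; exact hi01.symm⟩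
        · exact ⟨⟨i0, ⟨0, hp i0⟩⟩, hw⟩)
      i0 n (p i0) s (p i1) d (by exact_mod_cast hcardW) (by rw [hfibc]) (by exact_mod_cast hsplit)
      (by omega) (by omega) (by omega)
      (by
        intro i hi
        rw [hfibc]
        have : i1 ≤ i := by
          rw [Fin.le_def]
          have : i.1 ≠ 0 := fun h => hi (Fin.ext h)
          simp only [hi1]
          omega
        exact_mod_cast hmono this)
      (by omega) (by omega) (by omega) q (by omega) c' t hc' hno'
    have h2 : t + (d + 2) * s ≤ G.edgeSet.ncard + 1 := by exact_mod_cast this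
    omega
  exact hgr.csSup_eq
end
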